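/- Let p < q be odd primes with q ≤ 2p + 1 and let H be a non-semisimple Hopf algebra over ℂ of dimension p·q with antipode S. Then there exists a finite-dimensional H-module Q which is indecomposable, projective, of odd dimension over ℂ, and isomorphic to its double dual Q**; concretely, Q admits a ℂ-linear automorphism a such that a(x • v) = S²(x) • a(v) for all x ∈ H and v ∈ Q. -/

import Mathlib

/-- A bundled finite-dimensional `H`-module that is indecomposable, projective,
odd-dimensional over `ℂ`, and isomorphic to its double dual: it admits a
`ℂ`-linear automorphism `a` with `a (x • v) = S²(x) • a v`. -/
structure OddSelfBidualProjective (H : Type) [Ring H] [HopfAlgebra ℂ H] where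
  Q : Type
  [addCommGroup : AddCommGroup Q]
  [modC : Module ℂ Q]
  [modH : Module H Q]
  [tower : IsScalarTower ℂ H Q]
  finite : FiniteDimensional ℂ Q
  nontrivial : Nontrivial Q
  indecomposable : ¬ ∃ A B : Submodule H Q, A ≠ ⊥ ∧ B ≠ ⊥ ∧ IsCompl A B
  projective : Module.Projective H Q
  odd_dim : Odd (Module.finrank ℂ Q)
  self_bidual : ∃ a : Q ≃ₗ[ℂ] Q, ∀ (x : H) (v : Q),
    a (x • v) =
      (((HopfAlgebra.antipode (R := ℂ) (A := H) : Module.End ℂ H) ^ 2) x) • a v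

section
open scoped TensorProduct

section RepMod
variable {k A M : Type} [Field k] [Ring A] [Algebra k A] [AddCommGroup M] [Module k M]

/-- The `A`-module on `M` given by a representation `ρ`. -/
def RepMod (_ρ : A →ₐ[k] Module.End k M) : Type := M

namespace RepMod
variable (ρ : A →ₐ[k] Module.End k M)

instance : AddCommGroup (RepMod ρ) := inferInstanceAs (AddCommGroup M)
instance : Module k (RepMod ρ) := inferInstanceAs (Module k M)
instance : Module A (RepMod ρ) := Module.compHom M ρ.toRingHom
instance [Module.Finite k M] : Module.Finite k (RepMod ρ) := inferInstanceAs (Module.Finite k M)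

/-- The identity map. -/
def of : M ≃ₗ[k] RepMod ρ := LinearEquiv.refl k M

theorem smul_of (x : A) (m : M) : x • of ρ m = of ρ (ρ x m) := rfl

theorem smul_def (x : A) (m : RepMod ρ) : x • m = of ρ (ρ x ((of ρ).symm m)) := rfl

instance : IsScalarTower k A (RepMod ρ) where
  smul_assoc c x m := by
    rw [smul_def, smul_def, map_smul, LinearMap.smul_apply, map_smul]

end RepMod
end RepMod

section Diagonal
variable {k H : Type} [Field k] [Ring H] [Algebra k H]

open TensorProduct in
/-- A multiplicative coproduct `δ` together with an antimultiplicative map `T` behaving like an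
antipode: exactly what is needed for tensor products with projectives to be projective. -/
structure IsDiagonal (δ : H →ₐ[k] H ⊗[k] H) (T : H →ₗ[k] H) : Prop where
  map_mul : ∀ x y, T (x * y) = T y * T x
  mul_right : ∀ x, LinearMap.mul' k (H ⊗[k] H)
    (map δ.toLinearMap ((Algebra.TensorProduct.includeRight (R := k) (A := H)).toLinearMap ∘ₗ T)
      (δ x)) = x ⊗ₜ 1
  mul_left : ∀ x, LinearMap.mul' k (H ⊗[k] H)
    (map (T.lTensor H ∘ₗ δ.toLinearMap)
      (Algebra.TensorProduct.includeRight (R := k) (A := H)).toLinearMap (δ x)) = x ⊗ₜ 1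

variable {P W : Type} [AddCommGroup P] [Module k P] [Module H P] [IsScalarTower k H P]
  [AddCommGroup W] [Module k W] [Module H W] [IsScalarTower k H W]

variable (k H P W) in
/-- The action of `H ⊗ H` on `P ⊗ W`. -/
noncomputable def tensorAct : (H ⊗[k] H) →ₐ[k] Module.End k (P ⊗[k] W) :=
  (Module.endTensorEndAlgHom (R := k) (S := k) (A := k) (M := P) (N := W)).comp
    (Algebra.TensorProduct.map (Algebra.lsmul k k P) (Algebra.lsmul k k W))

@[simp]
theorem tensorAct_tmul (a b : H) (p : P) (w : W) :
    tensorAct k H P W (a ⊗ₜ b) (p ⊗ₜ w) = (a • p) ⊗ₜ (b • w) := by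
  simp [tensorAct, Module.endTensorEndAlgHom_apply]

variable (P W) in
/-- `P ⊗ W` with `H` acting through `δ`. -/
abbrev TMod (δ : H →ₐ[k] H ⊗[k] H) : Type := RepMod ((tensorAct k H P W).comp δ)

variable (P W) in
/-- The map `(a ⊗ b) ↦ (p ⊗ w ↦ a ⊗ p ⊗ T b w)`. -/
noncomputable def splitAux (T : H →ₗ[k] H) :
    (H ⊗[k] H) →ₗ[k] (P ⊗[k] W) →ₗ[k] (H ⊗[k] (P ⊗[k] W)) :=
  TensorProduct.lift (LinearMap.mk₂ k
    (fun a b => (TensorProduct.mk k H (P ⊗[k] W) a) ∘ₗ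
      (Algebra.lsmul k k W (T b) : W →ₗ[k] W).lTensor P)
    (by intros; ext; simp)
    (by intros; ext; simp [TensorProduct.smul_tmul'])
    (by intros; ext; simp [TensorProduct.tmul_add])
    (by intros; ext; simp))

@[simp]
theorem splitAux_tmul (T : H →ₗ[k] H) (a b : H) (p : P) (w : W) :
    splitAux P W T (a ⊗ₜ b) (p ⊗ₜ w) = a ⊗ₜ (p ⊗ₜ (T b • w)) := by
  simp [splitAux]

theorem splitAux_mul {T : H →ₗ[k] H} (hT : ∀ x y, T (x * y) = T y * T x) (c d : H)
    (u : H ⊗[k] H) (p : P) (w : W) :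
    splitAux P W T ((c ⊗ₜ d) * u) (p ⊗ₜ w) = c • splitAux P W T u (p ⊗ₜ (T d • w)) := by
  induction u with
  | zero => simp
  | tmul a b => simp [hT, mul_smul, TensorProduct.smul_tmul']
  | add x y hx hy => simp [mul_add, hx, hy]

variable (P W) in
/-- The map `h ⊗ p ⊗ w ↦ h₁ ⊗ p ⊗ T h₂ w`. -/
noncomputable def splitMap (δ : H →ₐ[k] H ⊗[k] H) (T : H →ₗ[k] H) :
    ((H ⊗[k] P) ⊗[k] W) →ₗ[k] (H ⊗[k] (P ⊗[k] W)) :=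
  TensorProduct.lift (splitAux P W T ∘ₗ δ.toLinearMap) ∘ₗ
    (TensorProduct.assoc k H P W).toLinearMap

@[simp]
theorem splitMap_tmul (δ : H →ₐ[k] H ⊗[k] H) (T : H →ₗ[k] H) (h : H) (p : P) (w : W) :
    splitMap P W δ T ((h ⊗ₜ p) ⊗ₜ w) = splitAux P W T (δ h) (p ⊗ₜ w) := by
  simp [splitMap]

variable (k H P) in
/-- The action map `H ⊗ P → P`, linear over `H`. -/
noncomputable def actMap : (H ⊗[k] P) →ₗ[H] P :=
  TensorProduct.AlgebraTensorModule.lift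
    ((LinearMap.toSpanSingleton H (P →ₗ[k] P) LinearMap.id))

@[simp]
theorem actMap_tmul (h : H) (p : P) : actMap k H P (h ⊗ₜ p) = h • p := by
  simp [actMap]

theorem exists_section [Module.Projective H P] :
    ∃ s : P →ₗ[H] (H ⊗[k] P), (actMap k H P) ∘ₗ s = LinearMap.id :=
  Module.projective_lifting_property _ _ fun p => ⟨1 ⊗ₜ p, by simp⟩

variable {δ : H →ₐ[k] H ⊗[k] H} {T : H →ₗ[k] H}

theorem splitMap_smul (hδ : IsDiagonal δ T) (x : H) (u : H ⊗[k] P) (w : W) :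
    splitMap P W δ T (tensorAct k H (H ⊗[k] P) W (δ x) (u ⊗ₜ w)) =
      x • splitMap P W δ T (u ⊗ₜ w) := by
  induction u with
  | zero => simp
  | add u v hu hv => simp only [TensorProduct.add_tmul, map_add, smul_add, hu, hv]
  | tmul h p =>
    let Φ : (H ⊗[k] H) →ₗ[k] (H ⊗[k] (P ⊗[k] W)) := TensorProduct.lift (LinearMap.mk₂ k
      (fun c e => c • splitAux P W T (δ h) (p ⊗ₜ (e • w)))
      (by intros; simp [add_smul]) (by intros; simp) (by intros; simp [add_smul, TensorProduct.tmul_add])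
      (by intro a c e; simp [smul_comm c a]))
    have key : ∀ (u : H ⊗[k] H) (b : H), splitAux P W T (u * δ h) (p ⊗ₜ (b • w)) =
        Φ (T.lTensor H u * (1 ⊗ₜ b)) := by
      intro u b
      induction u with
      | zero => simp
      | tmul c d => simp [splitAux_mul hδ.map_mul, Φ, mul_smul]
      | add x y hx hy => simp [add_mul, hx, hy]
    have key2 : ∀ t : H ⊗[k] H,
        splitMap P W δ T (tensorAct k H (H ⊗[k] P) W t ((h ⊗ₜ p) ⊗ₜ w)) =
        Φ (LinearMap.mul' k (H ⊗[k] H)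
    (TensorProduct.map (T.lTensor H ∘ₗ δ.toLinearMap)
      (Algebra.TensorProduct.includeRight (R := k) (A := H)).toLinearMap t)) := by
      intro t
      induction t with
      | zero => simp
      | tmul a b => simp [TensorProduct.smul_tmul', key]
      | add x y hx hy => simp only [map_add, LinearMap.add_apply, hx, hy]
    rw [key2, hδ.mul_left]
    simp [Φ]

theorem actMap_splitMap (hδ : IsDiagonal δ T) (u : H ⊗[k] P) (w : W) :
    actMap k H (TMod P W δ) ((RepMod.of ((tensorAct k H P W).comp δ)).toLinearMap.lTensor H
      (splitMap P W δ T (u ⊗ₜ w))) = RepMod.of _ (actMap k H P u ⊗ₜ w) := by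
  induction u with
  | zero => simp
  | add u v hu hv => simp only [TensorProduct.add_tmul, map_add, hu, hv]
  | tmul h p =>
    have key : ∀ t : H ⊗[k] H, actMap k H (TMod P W δ)
        ((RepMod.of ((tensorAct k H P W).comp δ)).toLinearMap.lTensor H
        (splitAux P W T t (p ⊗ₜ w))) = RepMod.of _ (tensorAct k H P W (LinearMap.mul' k (H ⊗[k] H)
    (TensorProduct.map δ.toLinearMap
      ((Algebra.TensorProduct.includeRight (R := k) (A := H)).toLinearMap ∘ₗ T) t)) (p ⊗ₜ w)) := by
      intro t
      induction t with
      | zero => simp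
      | tmul a b => simp [RepMod.smul_of]
      | add x y hx hy => simp only [map_add, LinearMap.add_apply, hx, hy]
    rw [splitMap_tmul, key, hδ.mul_right]
    simp

theorem exists_tMod_section [Module.Projective H P] (hδ : IsDiagonal δ T) :
    ∃ s : TMod P W δ →ₗ[H] (H ⊗[k] (TMod P W δ)),
      (actMap k H (TMod P W δ)) ∘ₗ s = LinearMap.id := by
  obtain ⟨s, hs⟩ := exists_section (k := k) (H := H) (P := P)
  let e := RepMod.of ((tensorAct k H P W).comp δ)
  let f : TMod P W δ →ₗ[k] (H ⊗[k] (TMod P W δ)) :=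
    e.toLinearMap.lTensor H ∘ₗ splitMap P W δ T ∘ₗ
      (s.restrictScalars k).rTensor W ∘ₗ e.symm.toLinearMap
  have hact : ∀ (x : H) (v : H ⊗[k] (P ⊗[k] W)),
      e.toLinearMap.lTensor H (x • v) = x • e.toLinearMap.lTensor H v := by
    intro x v
    induction v with
    | zero => simp
    | tmul a b => simp [TensorProduct.smul_tmul']
    | add x y hx hy => simp only [map_add, smul_add, hx, hy]
  refine ⟨{ f with map_smul' := ?_ }, ?_⟩
  · intro x m
    obtain ⟨m, rfl⟩ := e.surjective m
    have key : ∀ t : H ⊗[k] H, ∀ p w, (s.restrictScalars k).rTensor W (tensorAct k H P W t (p ⊗ₜ w)) =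
        tensorAct k H (H ⊗[k] P) W t (s p ⊗ₜ w) := by
      intro t p w
      induction t with
      | zero => simp
      | tmul a b => simp
      | add x y hx hy => simp only [map_add, LinearMap.add_apply, hx, hy]
    induction m with
    | zero => simp
    | add u v hu hv =>
      simp only [AddHom.toFun_eq_coe, LinearMap.coe_toAddHom] at hu hv ⊢
      simp only [map_add, smul_add, hu, hv]
    | tmul p w =>
      simp only [f, e, RepMod.smul_of, AddHom.toFun_eq_coe, LinearMap.coe_toAddHom, LinearMap.comp_apply,
        LinearEquiv.coe_coe, LinearEquiv.symm_apply_apply, AlgHom.comp_apply, key,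
        RingHom.id_apply, splitMap_smul hδ]
      erw [hact]
      rfl
  · ext m
    obtain ⟨m, rfl⟩ := e.surjective m
    induction m with
    | zero => simp
    | add u v hu hv => simp only [map_add, hu, hv] at hu hv ⊢
    | tmul p w =>
      have := actMap_splitMap hδ (s p) w
      have h2 : actMap k H P (s p) = p := LinearMap.congr_fun hs p
      rw [h2] at this
      simpa [f, e] using this

theorem projective_tMod [Module.Projective H P] (hδ : IsDiagonal δ T) :
    Module.Projective H (TMod P W δ) := by
  obtain ⟨s, hs⟩ := exists_tMod_section (P := P) (W := W) hδ
  exact Module.Projective.of_split s _ hs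

end Diagonal

open Coalgebra

section CoalgebraTranslations
variable {k H : Type} [Field k] [AddCommGroup H] [Module k H] [Coalgebra k H]

/-- The operator `x ↦ f(x₁) x₂`. -/
noncomputable def lOp (f : Module.Dual k H) : H →ₗ[k] H :=
  (TensorProduct.lid k H).toLinearMap ∘ₗ f.rTensor H ∘ₗ comul

/-- The operator `x ↦ x₁ f(x₂)`. -/
noncomputable def rOp (f : Module.Dual k H) : H →ₗ[k] H :=
  (TensorProduct.rid k H).toLinearMap ∘ₗ f.lTensor H ∘ₗ comul

theorem lOp_apply (f : Module.Dual k H) (x : H) :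
    lOp f x = TensorProduct.lid k H (f.rTensor H (comul x)) := rfl

theorem rOp_apply (f : Module.Dual k H) (x : H) :
    rOp f x = TensorProduct.rid k H (f.lTensor H (comul x)) := rfl

theorem comul_lOp (f : Module.Dual k H) (x : H) :
    comul (R := k) (lOp f x) = (lOp f).rTensor H (comul x) := by
  have h1 : ∀ t : H ⊗[k] H, comul (R := k) (TensorProduct.lid k H (f.rTensor H t)) =
      TensorProduct.lid k (H ⊗[k] H) (f.rTensor (H ⊗[k] H) (comul.lTensor H t)) := by
    intro t
    induction t with
    | zero => simp
    | tmul a b => simp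
    | add x y hx hy => simp only [map_add, hx, hy]
  have h3 : ∀ (u : H ⊗[k] H) (b : H), TensorProduct.lid k H (f.rTensor H u) ⊗ₜ[k] b =
      TensorProduct.lid k (H ⊗[k] H) (f.rTensor (H ⊗[k] H)
        (TensorProduct.assoc k H H H (u ⊗ₜ b))) := by
    intro u b
    induction u with
    | zero => simp
    | tmul a b => simp [TensorProduct.smul_tmul']
    | add x y hx hy => simp only [map_add, TensorProduct.add_tmul, hx, hy]
  have h2 : ∀ t : H ⊗[k] H, (lOp f).rTensor H t =
      TensorProduct.lid k (H ⊗[k] H) (f.rTensor (H ⊗[k] H)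
        (TensorProduct.assoc k H H H (comul.rTensor H t))) := by
    intro t
    induction t with
    | zero => simp
    | tmul a b => simp [lOp_apply, h3]
    | add x y hx hy => simp only [map_add, hx, hy]
  rw [lOp_apply, h1, h2, coassoc_apply]

theorem comul_rOp (f : Module.Dual k H) (x : H) :
    comul (R := k) (rOp f x) = (rOp f).lTensor H (comul x) := by
  have h1 : ∀ t : H ⊗[k] H, comul (R := k) (TensorProduct.rid k H (f.lTensor H t)) =
      TensorProduct.rid k (H ⊗[k] H) (f.lTensor (H ⊗[k] H) (comul.rTensor H t)) := by
    intro t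
    induction t with
    | zero => simp
    | tmul a b => simp
    | add x y hx hy => simp only [map_add, hx, hy]
  have h3 : ∀ (u : H ⊗[k] H) (b : H), b ⊗ₜ[k] TensorProduct.rid k H (f.lTensor H u) =
      TensorProduct.rid k (H ⊗[k] H) (f.lTensor (H ⊗[k] H)
        ((TensorProduct.assoc k H H H).symm (b ⊗ₜ u))) := by
    intro u b
    induction u with
    | zero => simp
    | tmul a b => simp
    | add x y hx hy => simp only [map_add, TensorProduct.tmul_add, hx, hy]
  have h2 : ∀ t : H ⊗[k] H, (rOp f).lTensor H t =
      TensorProduct.rid k (H ⊗[k] H) (f.lTensor (H ⊗[k] H)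
        ((TensorProduct.assoc k H H H).symm (comul.lTensor H t))) := by
    intro t
    induction t with
    | zero => simp
    | tmul a b => simp [rOp_apply, h3]
    | add x y hx hy => simp only [map_add, hx, hy]
  rw [rOp_apply, h1, h2, coassoc_symm_apply]

theorem rOp_rTensor_comul (f : Module.Dual k H) (x : H) :
    (rOp f).rTensor H (comul (R := k) x) = (lOp f).lTensor H (comul x) := by
  let F : (H ⊗[k] (H ⊗[k] H)) →ₗ[k] (H ⊗[k] H) :=
    ((TensorProduct.lid k H).toLinearMap ∘ₗ f.rTensor H).lTensor H
  have h3 : ∀ (u : H ⊗[k] H) (b : H), TensorProduct.rid k H (f.lTensor H u) ⊗ₜ[k] b =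
      F (TensorProduct.assoc k H H H (u ⊗ₜ b)) := by
    intro u b
    induction u with
    | zero => simp
    | tmul a b => simp [TensorProduct.smul_tmul, F]
    | add x y hx hy => simp only [map_add, TensorProduct.add_tmul, hx, hy]
  have h1 : ∀ t : H ⊗[k] H, (rOp f).rTensor H t =
      F (TensorProduct.assoc k H H H (comul.rTensor H t)) := by
    intro t
    induction t with
    | zero => simp
    | tmul a b => simp [rOp_apply, h3]
    | add x y hx hy => simp only [map_add, hx, hy]
  have h2 : ∀ t : H ⊗[k] H, (lOp f).lTensor H t = F (comul.lTensor H t) := by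
    intro t
    induction t with
    | zero => simp
    | tmul a b => simp [lOp_apply, F]
    | add x y hx hy => simp only [map_add, hx, hy]
  rw [h1, h2, coassoc_apply]

theorem lOp_comp_lOp (f g : Module.Dual k H) : lOp (g ∘ₗ lOp f) = lOp g ∘ₗ lOp f := by
  ext x
  rw [LinearMap.comp_apply, lOp_apply g, comul_lOp, lOp_apply, LinearMap.rTensor_comp_apply]

theorem rOp_comp_rOp (f g : Module.Dual k H) : rOp (g ∘ₗ rOp f) = rOp g ∘ₗ rOp f := by
  ext x
  rw [LinearMap.comp_apply, rOp_apply g, comul_rOp, rOp_apply, LinearMap.lTensor_comp_apply]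

theorem rOp_map_rTensor (f : Module.Dual k H) (g : Module.Dual k H) (t : H ⊗[k] H) :
    TensorProduct.lid k H (f.rTensor H ((rOp g).lTensor H t)) =
      rOp g (TensorProduct.lid k H (f.rTensor H t)) := by
  induction t with
  | zero => simp
  | tmul a b => simp
  | add x y hx hy => simp only [map_add, hx, hy]

theorem lOp_rOp (f g : Module.Dual k H) (x : H) : lOp f (rOp g x) = rOp g (lOp f x) := by
  rw [lOp_apply, comul_rOp, rOp_map_rTensor, lOp_apply]

@[simp]
theorem counit_lOp (f : Module.Dual k H) (x : H) : counit (R := k) (lOp f x) = f x := by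
  have h : ∀ t : H ⊗[k] H, counit (R := k) (TensorProduct.lid k H (f.rTensor H t)) =
      f (TensorProduct.rid k H (counit.lTensor H t)) := by
    intro t
    induction t with
    | zero => simp
    | tmul a b => simp [mul_comm]
    | add x y hx hy => simp only [map_add, hx, hy]
  rw [lOp_apply, h]; simp

@[simp]
theorem counit_rOp (f : Module.Dual k H) (x : H) : counit (R := k) (rOp f x) = f x := by
  have h : ∀ t : H ⊗[k] H, counit (R := k) (TensorProduct.rid k H (f.lTensor H t)) =
      f (TensorProduct.lid k H (counit.rTensor H t)) := by
    intro t
    induction t with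
    | zero => simp
    | tmul a b => simp [mul_comm]
    | add x y hx hy => simp only [map_add, hx, hy]
  rw [rOp_apply, h]; simp

@[simp]
theorem lOp_counit : lOp (counit (R := k) (A := H)) = LinearMap.id := by
  ext x; simp [lOp_apply]

@[simp]
theorem rOp_counit : rOp (counit (R := k) (A := H)) = LinearMap.id := by
  ext x; simp [rOp_apply]

theorem lOp_comp_rOp (f g : Module.Dual k H) (x : H) :
    lOp (f ∘ₗ rOp g) x = TensorProduct.lid k H (TensorProduct.map f (lOp g) (comul x)) := by
  rw [lOp_apply, LinearMap.rTensor_comp_apply, rOp_rTensor_comul, ← LinearMap.comp_apply,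
    LinearMap.rTensor_comp_lTensor]

end CoalgebraTranslations

section Antipode
variable {k H B : Type} [Field k] [Ring H] [HopfAlgebra k H] [Ring B] [Algebra k B]
open HopfAlgebra WithConv TensorProduct

theorem toConv_antipode_mul (φ : H →ₐ[k] B) :
    toConv (φ.toLinearMap ∘ₗ antipode k) * toConv φ.toLinearMap = 1 := by
  apply ofConv_injective
  have := LinearMap.algHom_comp_convMul_distrib φ (toConv (antipode k (A := H)))
    (toConv LinearMap.id)
  simp only [LinearMap.antipode_mul_id, ofConv_toConv, LinearMap.comp_id] at this
  rw [← this]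
  ext x
  simp [LinearMap.convOne_def]

theorem toConv_mul_antipode (φ : H →ₐ[k] B) :
    toConv φ.toLinearMap * toConv (φ.toLinearMap ∘ₗ antipode k) = 1 := by
  apply ofConv_injective
  have := LinearMap.algHom_comp_convMul_distrib φ
    (toConv LinearMap.id) (toConv (antipode k (A := H)))
  simp only [LinearMap.id_mul_antipode, ofConv_toConv, LinearMap.comp_id] at this
  rw [← this]
  ext x
  simp [LinearMap.convOne_def]

variable (k H)

/-- The inclusion of the left factor, as a linear map. -/
noncomputable abbrev inclL : H →ₐ[k] (H ⊗[k] H) :=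
  Algebra.TensorProduct.includeLeft (R := k) (S := k) (A := H) (B := H)

/-- The inclusion of the right factor, as a linear map. -/
noncomputable abbrev inclR : H →ₐ[k] (H ⊗[k] H) :=
  Algebra.TensorProduct.includeRight (R := k) (A := H) (B := H)

variable {k H}

theorem inclL_mul_inclR (f g : H →ₗ[k] H) :
    toConv ((inclL k H).toLinearMap ∘ₗ f) * toConv ((inclR k H).toLinearMap ∘ₗ g) =
      toConv (map f g ∘ₗ comul) := by
  apply ofConv_injective
  ext x
  change LinearMap.mul' k _ (map ((inclL k H).toLinearMap ∘ₗ f) ((inclR k H).toLinearMap ∘ₗ g)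
    (comul x)) = map f g (comul x)
  induction comul (R := k) x with
  | zero => simp
  | tmul a b => simp
  | add x y hx hy => simp only [map_add, hx, hy]

theorem inclR_mul_inclL (f g : H →ₗ[k] H) :
    toConv ((inclR k H).toLinearMap ∘ₗ f) * toConv ((inclL k H).toLinearMap ∘ₗ g) =
      toConv (map g f ∘ₗ (TensorProduct.comm k H H).toLinearMap ∘ₗ comul) := by
  apply ofConv_injective
  ext x
  change LinearMap.mul' k _ (map ((inclR k H).toLinearMap ∘ₗ f) ((inclL k H).toLinearMap ∘ₗ g)
    (comul x)) = map g f (TensorProduct.comm k H H (comul x))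
  induction comul (R := k) x with
  | zero => simp
  | tmul a b => simp
  | add x y hx hy => simp only [map_add, hx, hy]

theorem toConv_comul :
    toConv (inclL k H).toLinearMap * toConv (inclR k H).toLinearMap =
      toConv (comul (R := k) (A := H)) := by
  simpa using inclL_mul_inclR (k := k) (H := H) LinearMap.id LinearMap.id

theorem antipode_comul :
    toConv ((inclL k H).toLinearMap ∘ₗ antipode k) * toConv (comul (R := k) (A := H)) =
      toConv (inclR k H).toLinearMap := by
  rw [← toConv_comul, ← mul_assoc, toConv_antipode_mul, one_mul]

theorem comul_antipode_right :
    toConv (comul (R := k) (A := H)) * toConv ((inclR k H).toLinearMap ∘ₗ antipode k) =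
      toConv (inclL k H).toLinearMap := by
  rw [← toConv_comul, mul_assoc, toConv_mul_antipode, mul_one]

theorem sum_antipode_mul_comul {ι : Type} {y : H} (r : Coalgebra.Repr k y ι) :
    ∑ i ∈ r.index, (antipode k (r.left i) ⊗ₜ[k] (1 : H)) * comul (R := k) (r.right i) =
      1 ⊗ₜ[k] y := by
  have := congrArg (fun f => f.ofConv y) (antipode_comul (k := k) (H := H))
  simp only [] at this
  rw [r.convMul_apply] at this
  simpa using this

theorem sum_comul_mul_antipode {ι : Type} {y : H} (r : Coalgebra.Repr k y ι) :
    ∑ i ∈ r.index, comul (R := k) (r.left i) * ((1 : H) ⊗ₜ[k] antipode k (r.right i)) =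
      y ⊗ₜ[k] 1 := by
  have := congrArg (fun f => f.ofConv y) (comul_antipode_right (k := k) (H := H))
  simp only [] at this
  rw [r.convMul_apply] at this
  simpa using this

theorem comul_antipode (x : H) : comul (R := k) (antipode k x) =
    map (antipode k) (antipode k) (TensorProduct.comm k H H (comul (R := k) x)) := by
  have h1 : toConv ((inclR k H).toLinearMap ∘ₗ antipode k) *
      toConv ((inclL k H).toLinearMap ∘ₗ antipode k) * toConv (comul (R := k) (A := H)) = 1 := by
    rw [← toConv_comul, mul_assoc, ← mul_assoc _ (toConv (inclL k H).toLinearMap),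
      toConv_antipode_mul, one_mul, toConv_antipode_mul]
  have h2 := left_inv_eq_right_inv h1 LinearMap.comul_right_inv
  rw [inclR_mul_inclL] at h2
  exact (congrArg (fun f => f.ofConv x) h2).symm

variable (k H) in
/-- The opposite comultiplication. -/
noncomputable def copAlgHom : H →ₐ[k] (H ⊗[k] H) :=
  (Algebra.TensorProduct.comm k H H).toAlgHom.comp (Bialgebra.comulAlgHom k H)

theorem copAlgHom_apply (x : H) : copAlgHom k H x = TensorProduct.comm k H H (comul x) := rfl

theorem isDiagonal_comul : IsDiagonal (Bialgebra.comulAlgHom k H) (antipode k) where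
  map_mul := antipode_mul_antidistrib
  mul_right x := congrArg (fun f => f.ofConv x) (comul_antipode_right (k := k) (H := H))
  mul_left x := by
    have : toConv ((antipode k).lTensor H ∘ₗ comul (R := k)) * toConv (inclR k H).toLinearMap =
        toConv (inclL k H).toLinearMap := by
      have := inclL_mul_inclR (k := k) (H := H) LinearMap.id (antipode k)
      rw [LinearMap.lTensor, ← this, mul_assoc, toConv_antipode_mul, mul_one, LinearMap.comp_id]
    exact congrArg (fun f => f.ofConv x) this

theorem isDiagonal_cop (T : H →ₗ[k] H) (h1 : ∀ x, antipode k (T x) = x)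
    (h2 : ∀ x, T (antipode k x) = x) : IsDiagonal (copAlgHom k H) T where
  map_mul x y := by
    rw [← h1 x, ← h1 y, ← antipode_mul_antidistrib, h2, h2, h2]
  mul_right x := by
    obtain ⟨y, rfl⟩ : ∃ y, antipode k y = x := ⟨_, h1 x⟩
    have h : toConv ((map (antipode k) (antipode k)) ∘ₗ comul (R := k) (A := H)) *
        toConv (inclR k H).toLinearMap = toConv ((inclL k H).toLinearMap ∘ₗ antipode k) := by
      rw [← inclL_mul_inclR, mul_assoc, toConv_antipode_mul, mul_one]
    refine Eq.trans ?_ (congrArg (fun f => f.ofConv y) h)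
    change _ = LinearMap.mul' k _ (map ((map (antipode k) (antipode k)) ∘ₗ comul (R := k))
      (inclR k H).toLinearMap (comul y))
    rw [copAlgHom_apply, comul_antipode]
    induction comul (R := k) y with
    | zero => simp
    | tmul a b =>
      simp only [comm_tmul, _root_.TensorProduct.map_tmul, AlgHom.toLinearMap_apply, LinearMap.comp_apply, h2,
        copAlgHom_apply, comul_antipode, LinearMap.mul'_apply]
      congr 1
      induction comul (R := k) a with
      | zero => simp
      | tmul c d => simp
      | add x y hx hy => simp only [map_add, hx, hy]
    | add x y hx hy => simp only [map_add, hx, hy]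
  mul_left x := by
    obtain ⟨y, rfl⟩ : ∃ y, antipode k y = x := ⟨_, h1 x⟩
    have h : toConv ((map (antipode k) LinearMap.id) ∘ₗ comul (R := k) (A := H)) *
        toConv ((inclR k H).toLinearMap ∘ₗ antipode k) =
        toConv ((inclL k H).toLinearMap ∘ₗ antipode k) := by
      rw [← inclL_mul_inclR, LinearMap.comp_id, mul_assoc, toConv_mul_antipode, mul_one]
    refine Eq.trans ?_ (congrArg (fun f => f.ofConv y) h)
    change _ = LinearMap.mul' k _ (map ((map (antipode k) LinearMap.id) ∘ₗ comul (R := k))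
      ((inclR k H).toLinearMap ∘ₗ antipode k) (comul y))
    rw [copAlgHom_apply, comul_antipode]
    induction comul (R := k) y with
    | zero => simp
    | tmul a b =>
      simp only [comm_tmul, _root_.TensorProduct.map_tmul, AlgHom.toLinearMap_apply, LinearMap.comp_apply,
        copAlgHom_apply, comul_antipode, LinearMap.mul'_apply]
      congr 1
      induction comul (R := k) a with
      | zero => simp
      | tmul c d => simp [h2]
      | add x y hx hy => simp only [map_add, hx, hy]
    | add x y hx hy => simp only [map_add, hx, hy]

variable {V : Type} [AddCommGroup V] [Module k V] [Module H V] [IsScalarTower k H V]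

variable (V) in
/-- The action of `H` on the dual of `V` through an antimultiplicative map `T`. -/
noncomputable def dualRep (T : H →ₗ[k] H) (h1 : T 1 = 1) (h : ∀ x y, T (x * y) = T y * T x) :
    H →ₐ[k] Module.End k (Module.Dual k V) :=
  AlgHom.ofLinearMap
    { toFun x := (Algebra.lsmul k k V (T x) : V →ₗ[k] V).dualMap
      map_add' x y := by ext; simp [add_smul]
      map_smul' c x := by ext; simp }
    (by ext; simp [h1]) (by intro x y; ext; simp [h, mul_smul])

theorem dualRep_apply (T : H →ₗ[k] H) (h1 : T 1 = 1) (h : ∀ x y, T (x * y) = T y * T x)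
    (x : H) (f : Module.Dual k V) (v : V) : dualRep V T h1 h x f v = f (T x • v) := by
  simp [dualRep]

end Antipode

section Integral
variable {k H : Type} [Field k] [Ring H] [HopfAlgebra k H]
open HopfAlgebra Coalgebra

theorem hopf_nontrivial (k H : Type) [Field k] [Ring H] [HopfAlgebra k H] : Nontrivial H :=
  ⟨0, 1, fun h => by simpa using congrArg (counit (R := k)) h⟩

variable (k H) in
theorem exists_integral [Module.Finite k H] :
    ∃ Λ : H, Λ ≠ 0 ∧ ∀ y : H, y * Λ = counit (R := k) y • Λ := by
  classical
  have := hopf_nontrivial k H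
  let ρ := dualRep (k := k) (H := H) H (antipode k) antipode_one antipode_mul_antidistrib
  let W := RepMod ρ
  obtain ⟨s, hs⟩ := exists_tMod_section (k := k) (P := H) (W := W) (isDiagonal_comul (k := k) (H := H))
  let e0 : (H ⊗[k] W) ≃ₗ[k] (H →ₗ[k] H) :=
    (TensorProduct.comm k H W) ≪≫ₗ
    (TensorProduct.congr (RepMod.of ρ).symm (LinearEquiv.refl k H)) ≪≫ₗ dualTensorHomEquiv k H H
  have he0 : ∀ (p : H) (f : Module.Dual k H) (v : H), e0 (p ⊗ₜ RepMod.of ρ f) v = f v • p := by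
    intro p f v
    simp [e0]
  let e := RepMod.of ((tensorAct k H H W).comp (Bialgebra.comulAlgHom k H))
  let c := e (e0.symm LinearMap.id)
  have hact : ∀ (t : H ⊗[k] H) (m : H ⊗[k] W) (v : H), e0 (tensorAct k H H W t m) v =
      LinearMap.mul' k H (TensorProduct.map LinearMap.id
        (e0 m ∘ₗ LinearMap.mulRight k v ∘ₗ antipode k) t) := by
    intro t m v
    induction t with
    | zero => simp
    | add x y hx hy => simp only [map_add, LinearMap.add_apply, hx, hy]
    | tmul a b =>
      induction m with
      | zero => simp
      | add x y hx hy =>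
        simp only [map_add, LinearMap.add_apply, hx, hy, TensorProduct.map_tmul,
          LinearMap.comp_apply, LinearMap.mul'_apply, mul_add]
      | tmul p f =>
        obtain ⟨f, rfl⟩ := (RepMod.of ρ).surjective f
        have h1 : tensorAct k H H W (a ⊗ₜ b) (p ⊗ₜ RepMod.of ρ f) =
            (a * p) ⊗ₜ RepMod.of ρ (ρ b f) := by
          rw [tensorAct_tmul, RepMod.smul_of, smul_eq_mul]
        rw [h1, he0, dualRep_apply]
        simp [he0]
  have hc : ∀ x : H, x • c = counit (R := k) x • c := by
    intro x
    rw [RepMod.smul_of, ← map_smul]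
    congr 1
    apply e0.injective
    ext v
    rw [AlgHom.comp_apply, hact, LinearEquiv.apply_symm_apply, map_smul,
      LinearEquiv.apply_symm_apply]
    have h : ∀ t : H ⊗[k] H, LinearMap.mul' k H (TensorProduct.map LinearMap.id
        (LinearMap.id ∘ₗ LinearMap.mulRight k v ∘ₗ antipode k) t) =
        LinearMap.mul' k H ((antipode k).lTensor H t) * v := by
      intro t
      induction t with
      | zero => simp
      | add x y hx hy => simp only [map_add, hx, hy, add_mul]
      | tmul a b => simp [mul_assoc]
    rw [h]
    simp [Algebra.smul_def]
  have hc0 : s c ≠ 0 := by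
    intro h
    have h1 : c = 0 := by
      rw [← LinearMap.id_apply (R := H) c, ← hs, LinearMap.comp_apply, h, map_zero]
    have h2 : (LinearMap.id : H →ₗ[k] H) = 0 := by simpa [c] using h1
    simpa using LinearMap.congr_fun h2 1
  have hsc : ∀ x : H, x • s c = counit (R := k) x • s c := by
    intro x
    rw [← map_smul, hc, LinearMap.map_smul_of_tower]
  let b := Module.Basis.ofVectorSpace k (TMod H W (Bialgebra.comulAlgHom k H))
  let E := TensorProduct.equivFinsuppOfBasisRight (M := H) b
  have hE : ∀ (x : H) t i, E (x • t) i = x * E t i := by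
    intro x t i
    induction t with
    | zero => simp
    | tmul a b => simp [E, TensorProduct.smul_tmul', TensorProduct.equivFinsuppOfBasisRight_apply_tmul]
    | add u v hu hv => simp only [map_add, smul_add, Finsupp.add_apply, hu, hv, mul_add]
  obtain ⟨i, hi⟩ : ∃ i, E (s c) i ≠ 0 := by
    by_contra! h
    exact hc0 (E.injective (by ext i; simp [h]))
  exact ⟨_, hi, fun y => by rw [← hE, hsc, map_smul, Finsupp.smul_apply]⟩

theorem rOp_eq_sum {ι : Type} (f : Module.Dual k H) {x : H} (r : Coalgebra.Repr k x ι) :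
    rOp f x = ∑ i ∈ r.index, f (r.right i) • r.left i := by
  simp [rOp_apply, ← r.eq]

theorem lOp_smul (c : k) (f : Module.Dual k H) (x : H) : lOp (c • f) x = c • lOp f x := by
  simp [lOp_apply, LinearMap.rTensor_smul]

theorem lOp_eq_sum {ι : Type} (f : Module.Dual k H) {x : H} (r : Coalgebra.Repr k x ι) :
    lOp f x = ∑ i ∈ r.index, f (r.left i) • r.right i := by
  simp [lOp_apply, ← r.eq]

/-- The element `f(t₁) t₂`. -/
noncomputable def lContract (f : Module.Dual k H) : (H ⊗[k] H) →ₗ[k] H :=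
  (TensorProduct.lid k H).toLinearMap ∘ₗ f.rTensor H

/-- The element `t₁ f(t₂)`. -/
noncomputable def rContract (f : Module.Dual k H) : (H ⊗[k] H) →ₗ[k] H :=
  (TensorProduct.rid k H).toLinearMap ∘ₗ f.lTensor H

@[simp] theorem lContract_tmul (f : Module.Dual k H) (a b : H) :
    lContract f (a ⊗ₜ b) = f a • b := by simp [lContract]

@[simp] theorem rContract_tmul (f : Module.Dual k H) (a b : H) :
    rContract f (a ⊗ₜ b) = f b • a := by simp [rContract]

theorem lContract_comul (f : Module.Dual k H) (x : H) : lContract f (comul x) = lOp f x := rfl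
theorem rContract_comul (f : Module.Dual k H) (x : H) : rContract f (comul x) = rOp f x := rfl

theorem lContract_tmul_one_mul (f : Module.Dual k H) (y : H) (t : H ⊗[k] H) :
    lContract f ((y ⊗ₜ 1) * t) = lContract (f ∘ₗ LinearMap.mulLeft k y) t := by
  induction t with
  | zero => simp
  | add x y hx hy => simp only [mul_add, map_add, hx, hy]
  | tmul a b => simp

theorem lContract_one_tmul_mul (f : Module.Dual k H) (y : H) (t : H ⊗[k] H) :
    lContract f ((1 ⊗ₜ y) * t) = y * lContract f t := by
  induction t with
  | zero => simp
  | add x y hx hy => simp only [mul_add, map_add, hx, hy]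
  | tmul a b => simp

theorem lContract_mul_tmul_one (f : Module.Dual k H) (y : H) (t : H ⊗[k] H) :
    lContract f (t * (y ⊗ₜ 1)) = lContract (f ∘ₗ LinearMap.mulRight k y) t := by
  induction t with
  | zero => simp
  | add x y hx hy => simp only [add_mul, map_add, hx, hy]
  | tmul a b => simp

theorem lContract_mul_one_tmul (f : Module.Dual k H) (y : H) (t : H ⊗[k] H) :
    lContract f (t * (1 ⊗ₜ y)) = lContract f t * y := by
  induction t with
  | zero => simp
  | add x y hx hy => simp only [add_mul, map_add, hx, hy]
  | tmul a b => simp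

theorem rContract_tmul_one_mul (f : Module.Dual k H) (y : H) (t : H ⊗[k] H) :
    rContract f ((y ⊗ₜ 1) * t) = y * rContract f t := by
  induction t with
  | zero => simp
  | add x y hx hy => simp only [mul_add, map_add, hx, hy]
  | tmul a b => simp

theorem rContract_one_tmul_mul (f : Module.Dual k H) (y : H) (t : H ⊗[k] H) :
    rContract f ((1 ⊗ₜ y) * t) = rContract (f ∘ₗ LinearMap.mulLeft k y) t := by
  induction t with
  | zero => simp
  | add x y hx hy => simp only [mul_add, map_add, hx, hy]
  | tmul a b => simp

theorem rContract_mul_tmul_one (f : Module.Dual k H) (y : H) (t : H ⊗[k] H) :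
    rContract f (t * (y ⊗ₜ 1)) = rContract f t * y := by
  induction t with
  | zero => simp
  | add x y hx hy => simp only [add_mul, map_add, hx, hy]
  | tmul a b => simp

theorem rContract_mul_one_tmul (f : Module.Dual k H) (y : H) (t : H ⊗[k] H) :
    rContract f (t * (1 ⊗ₜ y)) = rContract (f ∘ₗ LinearMap.mulRight k y) t := by
  induction t with
  | zero => simp
  | add x y hx hy => simp only [add_mul, map_add, hx, hy]
  | tmul a b => simp

variable {Λ : H}

theorem one_tmul_mul_comul (hΛ : ∀ y : H, y * Λ = counit (R := k) y • Λ) (y : H) :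
    ((1 : H) ⊗ₜ[k] y) * comul (R := k) Λ = (antipode k y ⊗ₜ 1) * comul (R := k) Λ := by
  rw [← sum_antipode_mul_comul (ℛ k y), Finset.sum_mul]
  simp_rw [mul_assoc, ← Bialgebra.comul_mul, hΛ, map_smul]
  have h := congrArg (antipode k) (rOp_eq_sum (k := k) (counit) (ℛ k y))
  rw [rOp_counit, LinearMap.id_apply] at h
  simp only [h, map_sum, map_smul, TensorProduct.sum_tmul, Finset.sum_mul, mul_smul_comm,
    ← TensorProduct.smul_tmul', smul_mul_assoc]

theorem antipode_mul_lOp (hΛ : ∀ y : H, y * Λ = counit (R := k) y • Λ) (f : Module.Dual k H)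
    (y : H) : y * lOp f Λ = lOp (f ∘ₗ LinearMap.mulLeft k (antipode k y)) Λ := by
  rw [← lContract_comul, ← lContract_one_tmul_mul, one_tmul_mul_comul hΛ, lContract_tmul_one_mul,
    lContract_comul]

variable [Module.Finite k H]

theorem lOp_integral_surjective (h0 : Λ ≠ 0) (hΛ : ∀ y : H, y * Λ = counit (R := k) y • Λ)
    (x : H) : ∃ f : Module.Dual k H, lOp f Λ = x := by
  let Ψ : Module.Dual k H →ₗ[k] H :=
    { toFun f := lOp f Λ
      map_add' f g := by simp [lOp_apply, LinearMap.rTensor_add]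
      map_smul' c f := by simp [lOp_apply, LinearMap.rTensor_smul] }
  have hmul : ∀ y z, z ∈ LinearMap.range Ψ → y * z ∈ LinearMap.range Ψ := by
    rintro y _ ⟨f, rfl⟩
    exact ⟨_, (antipode_mul_lOp hΛ f y).symm⟩
  have hconv : ∀ A : H →ₗ[k] H, LinearMap.mul' k H (TensorProduct.map A LinearMap.id
      (comul (R := k) Λ)) ∈ LinearMap.range Ψ := by
    intro A
    let b := Module.Basis.ofVectorSpace k H
    have h : ∀ t : H ⊗[k] H, LinearMap.mul' k H (TensorProduct.map A LinearMap.id t) =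
        ∑ i, b i * lContract (b.coord i ∘ₗ A) t := by
      intro t
      induction t with
      | zero => simp
      | add x y hx hy => simp only [map_add, hx, hy, mul_add, Finset.sum_add_distrib]
      | tmul u v =>
        simp only [TensorProduct.map_tmul, LinearMap.mul'_apply, LinearMap.id_apply,
          lContract_tmul, LinearMap.comp_apply, mul_smul_comm, ← smul_mul_assoc]
        rw [← Finset.sum_mul]
        congr 1
        simpa using (b.sum_repr (A u)).symm
    rw [h]
    exact Submodule.sum_mem _ fun i _ => hmul _ _ ⟨_, rfl⟩
  obtain ⟨f, hf⟩ := Module.Projective.exists_dual_eq_one k h0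
  let F : WithConv (H →ₗ[k] H) := WithConv.toConv (Algebra.linearMap k H ∘ₗ f)
  let A := F * WithConv.toConv (antipode k)
  have h1 : A * WithConv.toConv LinearMap.id = F := by
    rw [mul_assoc, LinearMap.antipode_mul_id, mul_one]
  have h2 : LinearMap.mul' k H (TensorProduct.map A.ofConv LinearMap.id (comul (R := k) Λ)) =
      1 := by
    refine (congrArg (fun f => f.ofConv Λ) h1).trans ?_
    simp [F, hf]
  have := hmul x 1 (h2 ▸ hconv A.ofConv)
  rwa [mul_one] at this

theorem lOp_integral_injective (h0 : Λ ≠ 0) (hΛ : ∀ y : H, y * Λ = counit (R := k) y • Λ)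
    {f g : Module.Dual k H} (h : lOp f Λ = lOp g Λ) : f = g := by
  let Ψ : Module.Dual k H →ₗ[k] H :=
    { toFun f := lOp f Λ
      map_add' f g := by simp [lOp_apply, LinearMap.rTensor_add]
      map_smul' c f := by simp [lOp_apply, LinearMap.rTensor_smul] }
  have hs : Function.Surjective Ψ := lOp_integral_surjective h0 hΛ
  exact (LinearMap.injective_iff_surjective_of_finrank_eq_finrank
    (Subspace.dual_finrank_eq (K := k) (V := H))).2 hs h

/-- A left integral `Λ` together with the functional `lam` normalised by `lam(Λ₁) Λ₂ = 1`. -/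
structure IsFrobenius (Λ : H) (lam : Module.Dual k H) : Prop where
  ne_zero : Λ ≠ 0
  mul_eq : ∀ y : H, y * Λ = counit (R := k) y • Λ
  lOp_eq_one : lOp lam Λ = 1

variable (k H) in
theorem exists_isFrobenius : ∃ (Λ : H) (lam : Module.Dual k H), IsFrobenius Λ lam := by
  obtain ⟨Λ, h0, hΛ⟩ := exists_integral k H
  obtain ⟨lam, h⟩ := lOp_integral_surjective h0 hΛ 1
  exact ⟨Λ, lam, h0, hΛ, h⟩

namespace IsFrobenius
variable {lam : Module.Dual k H}

theorem lOp_eq (F : IsFrobenius Λ lam) (x : H) : lOp lam x = lam x • 1 := by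
  rw [← sub_eq_zero, ← Module.forall_dual_apply_eq_zero_iff k]
  intro g
  have h : g ∘ₗ lOp lam = g 1 • lam := by
    apply lOp_integral_injective F.ne_zero F.mul_eq
    rw [lOp_comp_lOp, LinearMap.comp_apply, lOp_smul, F.lOp_eq_one]
    simp [lOp_apply, Algebra.TensorProduct.one_def]
  have := LinearMap.congr_fun h x
  simp only [LinearMap.comp_apply, LinearMap.smul_apply, smul_eq_mul] at this
  simp [this, mul_comm]

theorem apply_integral (F : IsFrobenius Λ lam) : lam Λ = 1 := by
  have := congrArg (counit (R := k)) F.lOp_eq_one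
  simpa using this

theorem eq_smul (F : IsFrobenius Λ lam) {μ : Module.Dual k H} (hμ : ∀ x, lOp μ x = μ x • 1) :
    μ = μ Λ • lam := by
  apply lOp_integral_injective F.ne_zero F.mul_eq
  rw [hμ, lOp_smul, F.lOp_eq_one]

theorem rOp_eq (F : IsFrobenius Λ lam) (x : H) : rOp lam x = lam x • rOp lam Λ := by
  rw [← sub_eq_zero, ← Module.forall_dual_apply_eq_zero_iff k]
  intro f
  have h : ∀ x, lOp (f ∘ₗ rOp lam) x = (f ∘ₗ rOp lam) x • 1 := by
    intro x
    rw [lOp_comp_rOp, LinearMap.comp_apply, rOp_apply]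
    induction comul (R := k) x with
    | zero => simp
    | add x y hx hy => simp only [map_add, hx, hy, add_smul]
    | tmul a b => simp [F.lOp_eq, smul_smul]
  have := LinearMap.congr_fun (F.eq_smul h) x
  simp only [LinearMap.comp_apply, LinearMap.smul_apply, smul_eq_mul] at this
  simp [this, mul_comm]

theorem lOp_antipode (F : IsFrobenius Λ lam) (y : H) : lOp
    (lam ∘ₗ LinearMap.mulLeft k (antipode k y)) Λ = y := by
  rw [← antipode_mul_lOp F.mul_eq, F.lOp_eq_one, mul_one]

theorem antipode_injective (F : IsFrobenius Λ lam) : Function.Injective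
    (antipode k : H →ₗ[k] H) := by
  intro x y h
  rw [← F.lOp_antipode x, h, F.lOp_antipode]

theorem antipode_surjective (F : IsFrobenius Λ lam) : Function.Surjective
    (antipode k : H →ₗ[k] H) :=
  LinearMap.injective_iff_surjective.1 F.antipode_injective

theorem exists_eq_apply_mul (F : IsFrobenius Λ lam) (f : Module.Dual k H) : ∃ z, ∀ x, f x = lam
    (z * x) := by
  refine ⟨antipode k (lOp f Λ), fun x => ?_⟩
  have h := lOp_integral_injective F.ne_zero F.mul_eq (F.lOp_antipode (lOp f Λ))
  exact (LinearMap.congr_fun h x).symm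

theorem eq_of_apply_mul (F : IsFrobenius Λ lam) {x y : H} (h : ∀ z, lam (z * x) = lam (z * y)) :
    x = y := by
  rw [← sub_eq_zero, ← Module.forall_dual_apply_eq_zero_iff k]
  intro f
  obtain ⟨z, hz⟩ := F.exists_eq_apply_mul f
  rw [hz, mul_sub, map_sub, h, sub_self]

theorem integral_eq_smul (F : IsFrobenius Λ lam) {M : H}
    (hM : ∀ y : H, y * M = counit (R := k) y • M) :
    M = lam M • Λ := by
  apply F.eq_of_apply_mul
  intro z
  simp [hM, F.mul_eq, F.apply_integral, mul_comm]

theorem integral_mul (F : IsFrobenius Λ lam) (y : H) : Λ * y = lam (Λ * y) • Λ :=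
  F.integral_eq_smul fun z => by rw [← mul_assoc, F.mul_eq, smul_mul_assoc]

theorem exists_character (F : IsFrobenius Λ lam) : ∃ α : H →ₐ[k] k, ∀ y, Λ * y = α y • Λ := by
  refine ⟨AlgHom.ofLinearMap (lam ∘ₗ LinearMap.mulLeft k Λ) (by simp [F.apply_integral]) ?_,
    fun y => F.integral_mul y⟩
  intro x y
  simp only [LinearMap.comp_apply, LinearMap.mulLeft_apply]
  rw [← mul_assoc, F.integral_mul x, smul_mul_assoc, map_smul]
  simp [F.apply_integral]

theorem comul_mul (F : IsFrobenius Λ lam) {α : H →ₐ[k] k}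
    (hα : ∀ y, Λ * y = α y • Λ) (y : H) : comul (R := k) Λ * (y ⊗ₜ 1) =
    comul (R := k) Λ * (1 ⊗ₜ antipode k (lOp α.toLinearMap y)) := by
  rw [← sum_comul_mul_antipode (ℛ k y), Finset.mul_sum]
  simp_rw [← mul_assoc, ← Bialgebra.comul_mul, hα, map_smul]
  rw [lOp_eq_sum _ (ℛ k y)]
  simp [TensorProduct.tmul_sum, Finset.mul_sum]

theorem apply_mul_comm (F : IsFrobenius Λ lam) {α : H →ₐ[k] k}
    (hα : ∀ y, Λ * y = α y • Λ) (z y : H) :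
    lam (z * y) = lam (antipode k (antipode k (lOp α.toLinearMap y)) * z) := by
  have h : lam ∘ₗ LinearMap.mulRight k y =
      lam ∘ₗ LinearMap.mulLeft k (antipode k (antipode k (lOp α.toLinearMap y))) := by
    apply lOp_integral_injective F.ne_zero F.mul_eq
    rw [F.lOp_antipode, ← lContract_comul, ← lContract_mul_tmul_one, F.comul_mul hα,
      lContract_mul_one_tmul, lContract_comul, F.lOp_eq_one, one_mul]
  exact LinearMap.congr_fun h z

theorem antipode_cube (F : IsFrobenius Λ lam) {α : H →ₐ[k] k}
    (hα : ∀ y, Λ * y = α y • Λ) (y : H) :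
    antipode k (antipode k (antipode k (lOp α.toLinearMap
      (antipode k (lOp α.toLinearMap y))))) * rOp lam Λ = rOp lam Λ * y := by
  have h : lam ∘ₗ LinearMap.mulRight k (antipode k (lOp α.toLinearMap y)) =
      lam ∘ₗ LinearMap.mulLeft k (antipode k (antipode k (lOp α.toLinearMap
      (antipode k (lOp α.toLinearMap y))))) := by
    ext z
    exact F.apply_mul_comm hα z _
  rw [← rContract_comul lam Λ, ← rContract_tmul_one_mul, ← one_tmul_mul_comul F.mul_eq,
    rContract_one_tmul_mul, ← h, ← rContract_mul_one_tmul, ← F.comul_mul hα,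
    rContract_mul_tmul_one]

theorem isUnit (F : IsFrobenius Λ lam) : IsUnit (rOp lam Λ) := by
  have hε : counit (R := k) (rOp lam Λ) = 1 := by simp [F.apply_integral]
  have hg : comul (R := k) (rOp lam Λ) = rOp lam Λ ⊗ₜ rOp lam Λ := by
    rw [comul_rOp]
    nth_rw 1 [rOp_apply]
    induction comul (R := k) Λ with
    | zero => simp
    | add x y hx hy => simp only [map_add, hx, hy, TensorProduct.add_tmul]
    | tmul a b => simp [F.rOp_eq b, TensorProduct.smul_tmul']
  have h1 := mul_antipode_rTensor_comul_apply (R := k) (rOp lam Λ)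
  have h2 := mul_antipode_lTensor_comul_apply (R := k) (rOp lam Λ)
  simp only [hg, hε, LinearMap.rTensor_tmul, LinearMap.lTensor_tmul, LinearMap.mul'_apply,
    map_one] at h1 h2
  exact ⟨⟨_, _, h2, h1⟩, rfl⟩

end IsFrobenius

end Integral

section Translations
variable {k H : Type} [Field k] [Ring H] [HopfAlgebra k H]
open HopfAlgebra Coalgebra

theorem lOp_apply_antipode (f : Module.Dual k H) (x : H) :
    lOp f (antipode k x) = antipode k (rOp (f ∘ₗ antipode k) x) := by
  rw [lOp_apply, comul_antipode, rOp_apply]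
  induction comul (R := k) x with
  | zero => simp
  | add x y hx hy => simp only [map_add, hx, hy]
  | tmul a b => simp

theorem rOp_apply_antipode (f : Module.Dual k H) (x : H) :
    rOp f (antipode k x) = antipode k (lOp (f ∘ₗ antipode k) x) := by
  rw [rOp_apply, comul_antipode, lOp_apply]
  induction comul (R := k) x with
  | zero => simp
  | add x y hx hy => simp only [map_add, hx, hy]
  | tmul a b => simp

variable (χ : H →ₐ[k] k)

theorem comp_antipode_comp_lOp :
    (χ.toLinearMap ∘ₗ antipode k) ∘ₗ lOp χ.toLinearMap = counit := by
  ext x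
  have h := congrArg χ (sum_mul_antipode_eq_algebraMap_counit (ℛ k x))
  rw [LinearMap.comp_apply, lOp_eq_sum _ (ℛ k x)]
  simpa using h

theorem comp_antipode_comp_rOp :
    (χ.toLinearMap ∘ₗ antipode k) ∘ₗ rOp χ.toLinearMap = counit := by
  ext x
  have h := congrArg χ (sum_antipode_mul_eq_algebraMap_counit (ℛ k x))
  rw [LinearMap.comp_apply, rOp_eq_sum _ (ℛ k x)]
  simpa [mul_comm] using h

theorem comp_lOp_comp_antipode :
    χ.toLinearMap ∘ₗ lOp (χ.toLinearMap ∘ₗ antipode k) = counit := by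
  ext x
  have h := congrArg χ (sum_antipode_mul_eq_algebraMap_counit (ℛ k x))
  rw [LinearMap.comp_apply, lOp_eq_sum _ (ℛ k x)]
  simpa using h

theorem comp_rOp_comp_antipode :
    χ.toLinearMap ∘ₗ rOp (χ.toLinearMap ∘ₗ antipode k) = counit := by
  ext x
  have h := congrArg χ (sum_mul_antipode_eq_algebraMap_counit (ℛ k x))
  rw [LinearMap.comp_apply, rOp_eq_sum _ (ℛ k x)]
  simpa [mul_comm] using h

theorem lOp_mul (x y : H) :
    lOp χ.toLinearMap (x * y) = lOp χ.toLinearMap x * lOp χ.toLinearMap y := by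
  let φ : (H ⊗[k] H) →ₐ[k] H := (Algebra.TensorProduct.lid k H).toAlgHom.comp
    (Algebra.TensorProduct.map χ (AlgHom.id k H))
  have h : ∀ z, lOp χ.toLinearMap z = φ (comul z) := fun z => rfl
  rw [h, h, h, Bialgebra.comul_mul, map_mul]

theorem rOp_mul (x y : H) :
    rOp χ.toLinearMap (x * y) = rOp χ.toLinearMap x * rOp χ.toLinearMap y := by
  let φ : (H ⊗[k] H) →ₐ[k] H := (Algebra.TensorProduct.rid k k H).toAlgHom.comp
    (Algebra.TensorProduct.map (AlgHom.id k H) χ)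
  have h : ∀ z, rOp χ.toLinearMap z = φ (comul z) := fun z => rfl
  rw [h, h, h, Bialgebra.comul_mul, map_mul]

/-- The left translation by a character. -/
noncomputable def lAut : H ≃ₐ[k] H :=
  AlgEquiv.ofLinearEquiv
    (LinearEquiv.ofLinearMap (lOp χ.toLinearMap) (lOp (χ.toLinearMap ∘ₗ antipode k))
      (by rw [← lOp_comp_lOp, comp_lOp_comp_antipode, lOp_counit])
      (by rw [← lOp_comp_lOp, comp_antipode_comp_lOp, lOp_counit]))
    (by simp [lOp_apply, Algebra.TensorProduct.one_def]) (lOp_mul χ)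

/-- The right translation by a character. -/
noncomputable def rAut : H ≃ₐ[k] H :=
  AlgEquiv.ofLinearEquiv
    (LinearEquiv.ofLinearMap (rOp χ.toLinearMap) (rOp (χ.toLinearMap ∘ₗ antipode k))
      (by rw [← rOp_comp_rOp, comp_rOp_comp_antipode, rOp_counit])
      (by rw [← rOp_comp_rOp, comp_antipode_comp_rOp, rOp_counit]))
    (by simp [rOp_apply, Algebra.TensorProduct.one_def]) (rOp_mul χ)

theorem lAut_apply (x : H) : lAut χ x = lOp χ.toLinearMap x := rfl

theorem lAut_antipode (x : H) : lAut χ (antipode k x) = antipode k ((rAut χ).symm x) :=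
  lOp_apply_antipode _ _

theorem rAut_antipode (x : H) : rAut χ (antipode k x) = antipode k ((lAut χ).symm x) :=
  rOp_apply_antipode _ _

theorem lAut_rAut (x : H) : lAut χ (rAut χ x) = rAut χ (lAut χ x) := lOp_rOp _ _ _

variable (k H) in
/-- A system of automorphisms as in Radford's formula for the fourth power of the antipode. -/
structure RadfordSystem where
  l : H ≃ₐ[k] H
  r : H ≃ₐ[k] H
  s : H ≃ₐ[k] H
  T : H →ₗ[k] H
  u : Hˣ
  s_apply : ∀ x, s x = antipode k (antipode k x)
  antipode_T : ∀ x, antipode k (T x) = x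
  T_antipode : ∀ x, T (antipode k x) = x
  radford : ∀ x, s (s (l x)) * u = u * r x
  l_antipode : ∀ x, l (antipode k x) = antipode k (r.symm x)
  r_antipode : ∀ x, r (antipode k x) = antipode k (l.symm x)
  l_comm_r : ∀ x, l (r x) = r (l x)
  comul_l : ∀ x, comul (R := k) (l x) = TensorProduct.map l.toLinearMap LinearMap.id (comul (R := k) x)
  map_r : ∀ x, TensorProduct.map r.toLinearMap LinearMap.id (comul (R := k) x) =
    TensorProduct.map LinearMap.id l.toLinearMap (comul (R := k) x)
  comul_s : ∀ x, comul (R := k) (s x) = TensorProduct.map s.toLinearMap s.toLinearMap (comul (R := k) x)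

variable (k H) in
theorem nonempty_radfordSystem [Module.Finite k H] : Nonempty (RadfordSystem k H) := by
  obtain ⟨Λ, lam, F⟩ := exists_isFrobenius k H
  obtain ⟨α, hα⟩ := F.exists_character
  let e : H ≃ₗ[k] H := LinearEquiv.ofBijective (antipode k) ⟨F.antipode_injective, F.antipode_surjective⟩
  have he : ∀ x, e x = antipode k x := fun _ => rfl
  let s : H ≃ₐ[k] H := AlgEquiv.ofLinearEquiv (e ≪≫ₗ e)
    (by simp only [LinearEquiv.trans_apply, he, antipode_one])
    (by intro x y; simp only [LinearEquiv.trans_apply, he, antipode_mul_antidistrib])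
  refine ⟨⟨lAut α, rAut α, s, e.symm.toLinearMap, F.isUnit.unit, fun x => rfl,
    fun x => e.apply_symm_apply x, fun x => e.symm_apply_apply x, ?_, lAut_antipode α,
    rAut_antipode α, lAut_rAut α, comul_lOp _, rOp_rTensor_comul _, ?_⟩⟩
  · intro x
    have h := F.antipode_cube hα (rAut α x)
    rw [← lAut_apply, ← lAut_apply, lAut_antipode, lAut_rAut, AlgEquiv.symm_apply_apply] at h
    exact h
  · intro x
    change comul (R := k) (antipode k (antipode k x)) = _
    rw [comul_antipode, comul_antipode]
    induction comul (R := k) x with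
    | zero => simp
    | add x y hx hy => simp only [map_add, hx, hy]
    | tmul a b => rfl

namespace RadfordSystem
variable (D : RadfordSystem k H)

theorem l_comm_s : D.l * D.s = D.s * D.l := by
  ext x
  simp only [AlgEquiv.mul_apply, D.s_apply, D.l_antipode]
  congr 1
  apply D.r.injective
  rw [AlgEquiv.apply_symm_apply, D.r_antipode, AlgEquiv.symm_apply_apply]

theorem pow_antipode (n : ℤ) (x : H) :
    (D.r ^ n) (antipode k x) = antipode k ((D.l ^ (-n)) x) ∧
    (D.l ^ n) (antipode k x) = antipode k ((D.r ^ (-n)) x) := by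
  induction n generalizing x with
  | zero => simp
  | succ n ih =>
    rw [zpow_add_one, zpow_add_one, AlgEquiv.mul_apply, AlgEquiv.mul_apply, D.r_antipode,
      D.l_antipode, (ih _).1, (ih _).2, neg_add, zpow_add, zpow_add]
    exact ⟨rfl, rfl⟩
  | pred n ih =>
    have h1 : ∀ y, D.r⁻¹ (antipode k y) = antipode k (D.l y) := fun y =>
      D.r.injective (by rw [D.r_antipode, AlgEquiv.symm_apply_apply]; exact D.r.apply_symm_apply _)
    have h2 : ∀ y, D.l⁻¹ (antipode k y) = antipode k (D.r y) := fun y =>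
      D.l.injective (by rw [D.l_antipode, AlgEquiv.symm_apply_apply]; exact D.l.apply_symm_apply _)
    rw [zpow_sub_one, zpow_sub_one, AlgEquiv.mul_apply, AlgEquiv.mul_apply, h1, h2,
      (ih _).1, (ih _).2, neg_sub, sub_neg_eq_add, add_comm, zpow_add_one, zpow_add_one, neg_neg]
    exact ⟨rfl, rfl⟩

theorem map_r_inv (x : H) :
    TensorProduct.map (D.r⁻¹).toLinearMap LinearMap.id (comul (R := k) x) =
      TensorProduct.map LinearMap.id (D.l⁻¹).toLinearMap (comul (R := k) x) := by
  have h := congrArg (TensorProduct.map (D.r⁻¹).toLinearMap (D.l⁻¹).toLinearMap) (D.map_r x)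
  rw [TensorProduct.map_map, TensorProduct.map_map] at h
  have h1 : (D.r⁻¹).toLinearMap ∘ₗ D.r.toLinearMap = LinearMap.id :=
    LinearMap.ext fun x => D.r.symm_apply_apply x
  have h2 : (D.l⁻¹).toLinearMap ∘ₗ D.l.toLinearMap = LinearMap.id :=
    LinearMap.ext fun x => D.l.symm_apply_apply x
  rw [h1, h2, LinearMap.comp_id, LinearMap.comp_id] at h
  exact h.symm

theorem map_r_pow (n : ℤ) (x : H) :
    TensorProduct.map (D.r ^ n).toLinearMap LinearMap.id (comul (R := k) x) =
      TensorProduct.map LinearMap.id (D.l ^ n).toLinearMap (comul (R := k) x) := by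
  have key : ∀ (a b a' b' : H ≃ₐ[k] H) (t : H ⊗[k] H),
      TensorProduct.map a.toLinearMap LinearMap.id t = TensorProduct.map LinearMap.id b.toLinearMap t →
      TensorProduct.map a'.toLinearMap LinearMap.id t = TensorProduct.map LinearMap.id b'.toLinearMap t →
      TensorProduct.map (a * a').toLinearMap LinearMap.id t =
        TensorProduct.map LinearMap.id (b' * b).toLinearMap t := by
    intro a b a' b' t h h'
    have e1 : (a * a').toLinearMap = a.toLinearMap ∘ₗ a'.toLinearMap := rfl
    have e2 : (b' * b).toLinearMap = b'.toLinearMap ∘ₗ b.toLinearMap := rfl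
    have := congrArg (TensorProduct.map a.toLinearMap LinearMap.id) h'
    have h2 := congrArg (TensorProduct.map LinearMap.id b'.toLinearMap) h
    simp only [TensorProduct.map_map, LinearMap.id_comp, LinearMap.comp_id] at this h2
    rw [e1, e2, ← h2, ← this]
  induction n with
  | zero => rfl
  | succ n ih =>
    rw [zpow_add_one, add_comm, zpow_one_add]
    exact key _ _ _ _ _ ih (D.map_r x)
  | pred n ih =>
    rw [zpow_sub_one, sub_eq_neg_add, zpow_add _ (-1), zpow_neg_one]
    exact key _ _ _ _ _ ih (D.map_r_inv x)

theorem comul_l_inv (x : H) : comul (R := k) (D.l⁻¹ x) =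
    TensorProduct.map (D.l⁻¹).toLinearMap LinearMap.id (comul (R := k) x) := by
  obtain ⟨x, rfl⟩ := D.l.surjective x
  have h2 : (D.l⁻¹).toLinearMap ∘ₗ D.l.toLinearMap = LinearMap.id :=
    LinearMap.ext fun x => D.l.symm_apply_apply x
  rw [D.comul_l, ← LinearMap.comp_apply, ← TensorProduct.map_comp, h2]
  simp only [LinearMap.comp_id, TensorProduct.map_id, LinearMap.id_apply]
  exact congrArg _ (D.l.symm_apply_apply x)

theorem comul_l_pow (n : ℤ) (x : H) : comul (R := k) ((D.l ^ n) x) =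
    TensorProduct.map (D.l ^ n).toLinearMap LinearMap.id (comul (R := k) x) := by
  have key : ∀ (a b : H ≃ₐ[k] H) (t : H ⊗[k] H),
      TensorProduct.map (a * b).toLinearMap LinearMap.id t =
      TensorProduct.map a.toLinearMap LinearMap.id (TensorProduct.map b.toLinearMap LinearMap.id t) := by
    intro a b t
    rw [← LinearMap.comp_apply, ← TensorProduct.map_comp]
    rfl
  induction n with
  | zero =>
    change _ = TensorProduct.map LinearMap.id LinearMap.id (comul (R := k) x)
    rw [TensorProduct.map_id]
    rfl
  | succ n ih => rw [add_comm, zpow_one_add, AlgEquiv.mul_apply, D.comul_l, ih, key]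
  | pred n ih =>
    rw [sub_eq_neg_add, zpow_add, zpow_neg_one, AlgEquiv.mul_apply, D.comul_l_inv, ih, key]

theorem r_pow_eq_one {n : ℤ} (h : D.l ^ n = 1) : D.r ^ n = 1 := by
  ext x
  obtain ⟨y, rfl⟩ : ∃ y, antipode k y = x := ⟨_, D.antipode_T x⟩
  rw [(D.pow_antipode _ _).1, zpow_neg, h]
  simp

end RadfordSystem
end Translations

section Trace
variable {V : Type} [AddCommGroup V] [Module ℂ V] [Module.Finite ℂ V]

theorem Multiset.eq_one_of_sum_eq_card (s : Multiset ℂ) (hs : ∀ z ∈ s, ‖z‖ = 1)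
    (h : s.sum = s.card) : ∀ z ∈ s, z = 1 := by
  have hre : (s.map fun z => 1 - z.re).sum = 0 := by
    have h2 : (s.map Complex.re).sum = s.card := by
      have := congrArg Complex.reAddGroupHom h
      rw [map_multiset_sum] at this
      simpa using this
    rw [Multiset.sum_map_sub, h2]
    simp
  intro z hz
  have h0 : 1 - z.re = 0 := by
    refine Multiset.all_zero_of_le_zero_le_of_sum_eq_zero ?_ hre _ (Multiset.mem_map_of_mem _ hz)
    intro a ha
    obtain ⟨w, hw, rfl⟩ := Multiset.mem_map.1 ha
    have := Complex.re_le_norm w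
    rw [hs w hw] at this
    linarith
  have hn := hs z hz
  have h3 := Complex.sq_norm z
  rw [hn, Complex.normSq_apply] at h3
  have h1 : z.re = 1 := by linarith
  rw [h1] at h3
  apply Complex.ext
  · simpa using h1
  · have : z.im * z.im = 0 := by linarith
    simpa using this

theorem Module.End.eq_one_of_trace_eq {φ : Module.End ℂ V} {m : ℕ} (hm : m ≠ 0) (hφ : φ ^ m = 1)
    (h : LinearMap.trace ℂ V φ = Module.finrank ℂ V) : φ = 1 := by
  have hsp : φ.charpoly.Splits := IsAlgClosed.splits _
  have hev : ∀ z, φ.HasEigenvalue z → z ^ m = 1 := by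
    intro z hz
    obtain ⟨v, hv⟩ := hz.exists_hasEigenvector
    have := hv.pow_apply m
    rw [hφ, Module.End.one_apply] at this
    have h3 : (z ^ m - 1) • v = 0 := by rw [sub_smul, ← this, one_smul, sub_self]
    rcases smul_eq_zero.1 h3 with h4 | h4
    · exact sub_eq_zero.1 h4
    · exact absurd h4 hv.2
  have hroot : ∀ z ∈ φ.charpoly.roots, φ.HasEigenvalue z := fun z hz =>
    (Module.End.hasEigenvalue_iff_isRoot_charpoly φ z).2 (Polynomial.isRoot_of_mem_roots hz)
  have hone := Multiset.eq_one_of_sum_eq_card φ.charpoly.roots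
    (fun z hz => Complex.norm_eq_one_of_pow_eq_one (hev z (hroot z hz)) hm)
    (by rw [← Module.End.trace_eq_sum_roots_charpoly_of_splits hsp, h,
      ← hsp.natDegree_eq_card_roots, LinearMap.charpoly_natDegree])
  have hone' : ∀ z, φ.HasEigenvalue z → z = 1 := fun z hz => hone z
    ((Polynomial.mem_roots φ.charpoly_monic.ne_zero).2
      ((Module.End.hasEigenvalue_iff_isRoot_charpoly φ z).1 hz))
  by_contra hne
  let Q : Polynomial ℂ := ∑ j ∈ Finset.range m, Polynomial.X ^ j
  have hQ : Polynomial.aeval φ Q * (φ - 1) = 0 := by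
    have : Polynomial.aeval φ Q = ∑ j ∈ Finset.range m, φ ^ j := by simp [Q]
    rw [this, geom_sum_mul, hφ, sub_self]
  have h0 : (0 : ℂ) ∈ spectrum ℂ (Polynomial.aeval φ Q) := by
    rw [spectrum.zero_mem_iff]
    intro hu
    exact hne (sub_eq_zero.1 ((hu.mul_right_eq_zero).1 hQ))
  have hnt : Nontrivial V := by
    by_contra hV
    rw [not_nontrivial_iff_subsingleton] at hV
    exact hne (LinearMap.ext fun x => Subsingleton.elim _ _)
  rw [spectrum.map_polynomial_aeval_of_nonempty φ Q (spectrum.nonempty_of_isAlgClosed_of_finiteDimensional ℂ φ)] at h0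
  obtain ⟨z, hz, hz0⟩ := h0
  rw [hone' z (Module.End.hasEigenvalue_iff_mem_spectrum.2 hz)] at hz0
  simp [Q, Polynomial.eval_finsetSum, hm] at hz0

end Trace

section Order
variable {H : Type} [Ring H] [HopfAlgebra ℂ H]
open HopfAlgebra Coalgebra

variable (H) in
/-- The Galois map `x ⊗ y ↦ x y₁ ⊗ y₂`. -/
noncomputable def galoisMap : (H ⊗[ℂ] H) →ₗ[ℂ] (H ⊗[ℂ] H) :=
  LinearMap.mul' ℂ _ ∘ₗ TensorProduct.map (inclL ℂ H).toLinearMap (comul (R := ℂ) (A := H))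

@[simp]
theorem galoisMap_tmul (x y : H) : galoisMap H (x ⊗ₜ y) = (x ⊗ₜ 1) * comul (R := ℂ) y := by
  simp [galoisMap]

theorem galoisMap_mul (x : H) (t : H ⊗[ℂ] H) :
    galoisMap H ((x ⊗ₜ 1) * t) = (x ⊗ₜ 1) * galoisMap H t := by
  induction t with
  | zero => simp
  | add a b ha hb => simp only [mul_add, map_add, ha, hb]
  | tmul a b => simp [← mul_assoc]

theorem galoisMap_surjective : Function.Surjective (galoisMap H) := by
  intro t
  induction t with
  | zero => exact ⟨0, map_zero _⟩
  | add a b ha hb =>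
    obtain ⟨a, rfl⟩ := ha
    obtain ⟨b, rfl⟩ := hb
    exact ⟨a + b, map_add _ _ _⟩
  | tmul x y =>
    refine ⟨(x ⊗ₜ 1) * ∑ i ∈ (ℛ ℂ y).index,
      antipode ℂ ((ℛ ℂ y).left i) ⊗ₜ[ℂ] (ℛ ℂ y).right i, ?_⟩
    rw [galoisMap_mul, map_sum]
    simp only [galoisMap_tmul]
    rw [sum_antipode_mul_comul]
    simp

variable [Module.Finite ℂ H]

theorem trace_mul_self_of_comul (φ : H ≃ₐ[ℂ] H)
    (h : ∀ x, comul (R := ℂ) (φ x) = TensorProduct.map φ.toLinearMap LinearMap.id (comul (R := ℂ) x)) :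
    LinearMap.trace ℂ H φ.toLinearMap * LinearMap.trace ℂ H φ.toLinearMap =
      LinearMap.trace ℂ H φ.toLinearMap * Module.finrank ℂ H := by
  let e : (H ⊗[ℂ] H) ≃ₗ[ℂ] (H ⊗[ℂ] H) := LinearEquiv.ofBijective (galoisMap H)
    ⟨LinearMap.injective_iff_surjective.2 galoisMap_surjective, galoisMap_surjective⟩
  have hconj : e.conj (TensorProduct.map φ.toLinearMap φ.toLinearMap) =
      TensorProduct.map φ.toLinearMap LinearMap.id := by
    apply LinearMap.ext
    intro t
    obtain ⟨t, rfl⟩ := e.surjective t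
    rw [LinearEquiv.conj_apply_apply, LinearEquiv.symm_apply_apply]
    change galoisMap H _ = TensorProduct.map _ _ (galoisMap H t)
    induction t with
    | zero => simp
    | add a b ha hb => simp only [map_add, ha, hb]
    | tmul x y =>
      have hmul : ∀ t : H ⊗[ℂ] H, TensorProduct.map φ.toLinearMap LinearMap.id ((x ⊗ₜ 1) * t) =
          (φ x ⊗ₜ 1) * TensorProduct.map φ.toLinearMap LinearMap.id t := by
        intro t
        induction t with
        | zero => simp
        | add a b ha hb => simp only [mul_add, map_add, ha, hb]
        | tmul a b => simp
      rw [TensorProduct.map_tmul, galoisMap_tmul, galoisMap_tmul, hmul, ← h]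
      rfl
  rw [← LinearMap.trace_id ℂ H, ← LinearMap.trace_tensorProduct', ← LinearMap.trace_tensorProduct',
    ← hconj, LinearMap.trace_conj']

namespace RadfordSystem
variable (D : RadfordSystem ℂ H)

theorem l_zpow_eq_one {n : ℤ} (h : ∀ x, counit (R := ℂ) ((D.l ^ n) x) = counit (R := ℂ) x) :
    D.l ^ n = 1 := by
  ext x
  have h1 := congrArg (fun t => TensorProduct.lid ℂ H ((counit (R := ℂ)).rTensor H t))
    (D.comul_l_pow n x)
  have h2 : counit (R := ℂ) ∘ₗ (D.l ^ n).toLinearMap = counit (R := ℂ) (A := H) :=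
    LinearMap.ext h
  simp only [rTensor_counit_comul, TensorProduct.lid_tmul, one_smul] at h1
  rw [LinearMap.rTensor, TensorProduct.map_map, h2, LinearMap.comp_id, ← LinearMap.rTensor,
    rTensor_counit_comul, TensorProduct.lid_tmul, one_smul] at h1
  exact h1

theorem isOfFinOrder_l : IsOfFinOrder D.l := by
  rw [← not_not (a := IsOfFinOrder D.l), ← injective_pow_iff_not_isOfFinOrder]
  intro hinj
  let c : ℕ → H →ₐ[ℂ] ℂ := fun n => (Bialgebra.counitAlgHom ℂ H).comp (D.l ^ n : H ≃ₐ[ℂ] H).toAlgHom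
  have hc : Function.Injective c := by
    intro a b hab
    apply hinj
    have h : D.l ^ ((a : ℤ) - b) = 1 := by
      apply D.l_zpow_eq_one
      intro x
      have := DFunLike.congr_fun hab ((D.l ^ (-(b : ℤ))) x)
      change counit (R := ℂ) ((D.l ^ a) _) = counit (R := ℂ) ((D.l ^ b) _) at this
      rw [← AlgEquiv.mul_apply, ← AlgEquiv.mul_apply, ← zpow_natCast, ← zpow_natCast, ← zpow_add,
        ← zpow_add, add_neg_cancel] at this
      exact this
    rw [zpow_sub, mul_inv_eq_one, zpow_natCast, zpow_natCast] at h
    exact h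
  exact Module.Finite.not_linearIndependent_of_infinite _
    ((linearIndependent_toLinearMap ℂ H ℂ).comp c hc)

theorem trace_l_pow {m : ℕ} (hm : D.l ^ m ≠ 1) :
    LinearMap.trace ℂ H (D.l ^ m).toLinearMap = 0 := by
  have h := trace_mul_self_of_comul (D.l ^ m) fun x => by simpa using D.comul_l_pow m x
  rcases eq_or_ne (LinearMap.trace ℂ H (D.l ^ m).toLinearMap) 0 with h0 | h0
  · exact h0
  · refine absurd ?_ hm
    have hpow : ∀ j : ℕ, (D.l ^ m).toLinearMap ^ j = ((D.l ^ m) ^ j).toLinearMap := by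
      intro j
      induction j with
      | zero => rfl
      | succ j ih => rw [pow_succ, ih, pow_succ]; rfl
    have := Module.End.eq_one_of_trace_eq (φ := (D.l ^ m).toLinearMap)
      D.isOfFinOrder_l.orderOf_pos.ne'
      (by rw [hpow, ← pow_mul, mul_comm, pow_mul, pow_orderOf_eq_one, one_pow]; rfl)
      (mul_left_cancel₀ h0 h)
    ext x
    exact DFunLike.congr_fun this x

theorem orderOf_l_dvd : orderOf D.l ∣ Module.finrank ℂ H := by
  set n := orderOf D.l with hn
  have hn0 : (n : ℂ) ≠ 0 := Nat.cast_ne_zero.2 D.isOfFinOrder_l.orderOf_pos.ne'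
  let φ : Module.End ℂ H := D.l.toLinearMap
  have hpow : ∀ j : ℕ, φ ^ j = (D.l ^ j).toLinearMap := by
    intro j
    induction j with
    | zero => rfl
    | succ j ih => rw [pow_succ, ih, pow_succ]; rfl
  have hφ : φ ^ n = 1 := by rw [hpow, pow_orderOf_eq_one]; rfl
  let N : Module.End ℂ H := ∑ j ∈ Finset.range n, φ ^ j
  have hN : φ * N = N := by
    have h := mul_geom_sum φ n
    rw [hφ, sub_self, sub_mul, one_mul, sub_eq_zero] at h
    exact h
  have hNj : ∀ j : ℕ, φ ^ j * N = N := by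
    intro j
    induction j with
    | zero => simp
    | succ j ih => rw [pow_succ, mul_assoc, hN, ih]
  have hNN : N * N = (n : ℂ) • N := by
    conv_lhs => enter [1]; change ∑ j ∈ Finset.range n, φ ^ j
    rw [Finset.sum_mul, Finset.sum_congr rfl fun j _ => hNj j, Finset.sum_const, Finset.card_range,
      Nat.cast_smul_eq_nsmul]
  have hidem : IsIdempotentElem ((n : ℂ)⁻¹ • N) := by
    rw [IsIdempotentElem, smul_mul_smul_comm, hNN, smul_smul, mul_assoc, inv_mul_cancel₀ hn0, mul_one]
  have htr : LinearMap.trace ℂ H N = Module.finrank ℂ H := by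
    change LinearMap.trace ℂ H (∑ j ∈ Finset.range n, φ ^ j) = _
    rw [map_sum, Finset.sum_eq_single 0]
    · rw [pow_zero, LinearMap.trace_one]
    · intro j hj hj0
      rw [hpow]
      exact D.trace_l_pow (pow_ne_one_of_lt_orderOf hj0 (Finset.mem_range.1 hj))
    · intro h
      exact absurd (Finset.mem_range.2 D.isOfFinOrder_l.orderOf_pos) h
  have h := (LinearMap.IsIdempotentElem.isProj_range _ hidem).trace
  rw [map_smul, htr, smul_eq_mul, inv_mul_eq_iff_eq_mul₀ hn0] at h
  exact ⟨_, by exact_mod_cast h⟩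

end RadfordSystem
end Order

section Endomorphisms
variable {A : Type} [Ring A]
variable {P Q V W : Type} [AddCommGroup P] [Module A P] [AddCommGroup Q] [Module A Q]
  [AddCommGroup V] [Module A V] [AddCommGroup W] [Module A W]

variable (A P) in
/-- Every endomorphism is nilpotent or bijective. -/
def HasFitting : Prop := ∀ f : Module.End A P, IsNilpotent f ∨ Function.Bijective f

theorem HasFitting.bijective (hP : HasFitting A P) {f : P →ₗ[A] V} (hf : f ≠ 0)
    {g : Module.End A P} (h : f ∘ₗ g = f) : Function.Bijective g := by
  refine (hP g).resolve_left ?_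
  rintro ⟨n, hn⟩
  have key : ∀ n : ℕ, f ∘ₗ (g ^ n) = f := by
    intro n
    induction n with
    | zero => rfl
    | succ n ih => rw [pow_succ', Module.End.mul_eq_comp, ← LinearMap.comp_assoc, h, ih]
  apply hf
  rw [← key n, hn, LinearMap.comp_zero]

theorem HasFitting.not_isCompl (hP : HasFitting A P) :
    ¬ ∃ B C : Submodule A P, B ≠ ⊥ ∧ C ≠ ⊥ ∧ IsCompl B C := by
  rintro ⟨B, C, hB, hC, h⟩
  rcases hP (Submodule.projection B C h) with hn | hb
  · obtain ⟨b, hb, hb0⟩ := Submodule.exists_mem_ne_zero_of_ne_bot hB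
    obtain ⟨n, hn⟩ := hn
    have key : ∀ n : ℕ, (Submodule.projection B C h ^ n) b = b := by
      intro n
      induction n with
      | zero => rfl
      | succ n ih =>
        rw [pow_succ', Module.End.mul_apply, ih]
        exact Submodule.projection_apply_left h ⟨b, hb⟩
    apply hb0
    rw [← key n, hn, LinearMap.zero_apply]
  · obtain ⟨c, hc, hc0⟩ := Submodule.exists_mem_ne_zero_of_ne_bot hC
    apply hc0
    apply hb.1
    rw [map_zero]
    exact Submodule.projection_apply_right h ⟨c, hc⟩

theorem HasFitting.ker_le_ker [Module.Projective A P] (hP : HasFitting A P) {f : P →ₗ[A] V}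
    (hf : f ≠ 0) [IsSimpleModule A W] {g : P →ₗ[A] W} (hg : g ≠ 0) :
    LinearMap.ker f ≤ LinearMap.ker g := by
  by_contra hle
  have hne : g ∘ₗ (LinearMap.ker f).subtype ≠ 0 := by
    intro h
    exact hle fun x hx => LinearMap.congr_fun h ⟨x, hx⟩
  obtain ⟨e, he⟩ := Module.projective_lifting_property _ g (LinearMap.surjective_of_ne_zero hne)
  have hb : Function.Bijective ((LinearMap.ker f).subtype ∘ₗ e) :=
    hP.bijective hg (by rw [← LinearMap.comp_assoc, he])
  apply hf
  ext x
  obtain ⟨y, rfl⟩ := hb.2 x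
  exact (e y).2

theorem HasFitting.exists_comp_eq [Module.Projective A P] (hP : HasFitting A P)
    [IsSimpleModule A V] [IsSimpleModule A W] {f : P →ₗ[A] V} (hf : f ≠ 0) {g : P →ₗ[A] W} (hg : g ≠ 0) :
    ∃ t : V ≃ₗ[A] W, t.toLinearMap ∘ₗ f = g := by
  have hk : LinearMap.ker f = LinearMap.ker g := le_antisymm (hP.ker_le_ker hf hg) (hP.ker_le_ker hg hf)
  let e1 := f.quotKerEquivOfSurjective (LinearMap.surjective_of_ne_zero hf)
  let e2 := g.quotKerEquivOfSurjective (LinearMap.surjective_of_ne_zero hg)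
  refine ⟨e1.symm ≪≫ₗ Submodule.quotEquivOfEq _ _ hk ≪≫ₗ e2, ?_⟩
  ext x
  have : e1.symm (f x) = Submodule.Quotient.mk x := by
    rw [LinearEquiv.symm_apply_eq]; rfl
  simp only [LinearMap.comp_apply, LinearEquiv.coe_coe, LinearEquiv.trans_apply, this]
  rfl

/-- If `f : Q → V` and `g : P → V` are nonzero maps to a simple module, with `P` and `Q` projective
and `P` local, then `P` is a direct summand of `Q`. -/
theorem HasFitting.exists_split [Module.Projective A P] (hP : HasFitting A P)
    [Module.Projective A Q]
    [IsSimpleModule A V] {f : P →ₗ[A] V} (hf : f ≠ 0) {g : Q →ₗ[A] V} (hg : g ≠ 0) :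
    ∃ (i : P →ₗ[A] Q) (r : Q →ₗ[A] P), r ∘ₗ i = LinearMap.id := by
  obtain ⟨i, hi⟩ := Module.projective_lifting_property g f (LinearMap.surjective_of_ne_zero hg)
  obtain ⟨r, hr⟩ := Module.projective_lifting_property f g (LinearMap.surjective_of_ne_zero hf)
  have hb : Function.Bijective (r ∘ₗ i) :=
    hP.bijective hf (by rw [← LinearMap.comp_assoc, hr, hi])
  let e := LinearEquiv.ofBijective _ hb
  exact ⟨i, e.symm.toLinearMap ∘ₗ r, LinearMap.ext fun x => e.symm_apply_apply x⟩

end Endomorphisms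

section FiniteDim
variable {A : Type} [Ring A] [Algebra ℂ A]
variable {P Q V W : Type} [AddCommGroup P] [Module A P] [Module ℂ P] [IsScalarTower ℂ A P]
  [AddCommGroup Q] [Module A Q] [Module ℂ Q] [IsScalarTower ℂ A Q]
  [AddCommGroup V] [Module A V] [Module ℂ V] [IsScalarTower ℂ A V]
  [AddCommGroup W] [Module A W] [Module ℂ W] [IsScalarTower ℂ A W]

instance Submodule.finite_of_tower [Module.Finite ℂ Q] (N : Submodule A Q) : Module.Finite ℂ N :=
  inferInstanceAs (Module.Finite ℂ (N.restrictScalars ℂ))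

theorem HasFitting.finrank_hom_self [Module.Projective A P] (hP : HasFitting A P)
    [IsSimpleModule A V] [Module.Finite ℂ V] {f : P →ₗ[A] V} (hf : f ≠ 0) :
    Module.finrank ℂ (P →ₗ[A] V) = 1 := by
  refine finrank_eq_one f hf fun g => ?_
  rcases eq_or_ne g 0 with rfl | hg
  · exact ⟨0, zero_smul _ _⟩
  obtain ⟨t, ht⟩ := hP.exists_comp_eq hf hg
  obtain ⟨c, hc⟩ := (IsSimpleModule.algebraMap_end_bijective_of_isAlgClosed (A := A) (V := V) ℂ).2
    t.toLinearMap
  refine ⟨c, ?_⟩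
  rw [← ht, ← hc]
  rfl

theorem finrank_lt_of_ne_top [Module.Finite ℂ Q] {N : Submodule A Q} (h : N ≠ ⊤) :
    Module.finrank ℂ N < Module.finrank ℂ Q :=
  Submodule.finrank_lt (s := N.restrictScalars ℂ) (by simpa using h)

theorem exists_hasFitting [Module.Finite ℂ A] [IsSimpleModule A V] : ∃ P : Submodule A A,
    Module.Projective A P ∧ HasFitting A P ∧ ∃ f : P →ₗ[A] V, f ≠ 0 := by
  let S : Set (Submodule A A) := {P | Module.Projective A P ∧ ∃ f : P →ₗ[A] V, f ≠ 0}
  have hS : S.Nonempty := by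
    have := IsSimpleModule.nontrivial A V
    obtain ⟨v, hv⟩ := exists_ne (0 : V)
    refine ⟨⊤, Module.Projective.of_equiv' Submodule.topEquiv.symm,
      LinearMap.toSpanSingleton A V v ∘ₗ (⊤ : Submodule A A).subtype, fun h => hv ?_⟩
    simpa using LinearMap.congr_fun h ⟨1, trivial⟩
  obtain ⟨P, ⟨hP, f, hf⟩, hmin⟩ := (measure fun P : Submodule A A => Module.finrank ℂ P).wf.has_min S hS
  refine ⟨P, hP, ?_, f, hf⟩
  have key : ∀ K R : Submodule A P, IsCompl K R → f ∘ₗ K.subtype ≠ 0 → K = ⊤ := by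
    intro K R hKR hne
    by_contra htop
    let e : K ≃ₗ[A] K.map P.subtype := Submodule.equivMapOfInjective _ P.injective_subtype K
    have hpK : Module.Projective A K := Module.Projective.of_split K.subtype
      (K.projectionOnto R hKR) (Submodule.projectionOnto_comp_subtype hKR)
    refine hmin (K.map P.subtype) ⟨Module.Projective.of_equiv' e,
      (f ∘ₗ K.subtype) ∘ₗ e.symm.toLinearMap, fun h => hne ?_⟩ ?_
    · ext x
      simpa using LinearMap.congr_fun h (e x)
    · change Module.finrank ℂ _ < Module.finrank ℂ P
      rw [← (e.restrictScalars ℂ).finrank_eq]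
      exact finrank_lt_of_ne_top htop
  intro g
  have hA : IsNoetherian A P := isNoetherian_of_tower ℂ inferInstance
  have hA' : IsArtinian A P := isArtinian_of_tower ℂ inferInstance
  obtain ⟨n, hn, hcompl⟩ := ((Filter.eventually_gt_atTop 0).and
    (LinearMap.eventually_isCompl_ker_pow_range_pow g)).exists
  by_cases hker : f ∘ₗ (LinearMap.ker (g ^ n)).subtype = 0
  · right
    have hrange : LinearMap.range (g ^ n) = ⊤ := by
      refine key _ _ hcompl.symm fun h => hf ?_
      have hle : ∀ N : Submodule A P, f ∘ₗ N.subtype = 0 → N ≤ LinearMap.ker f := fun N h x hx =>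
        LinearMap.congr_fun h ⟨x, hx⟩
      rw [← LinearMap.ker_eq_top, eq_top_iff, ← hcompl.sup_eq_top]
      exact sup_le (hle _ hker) (hle _ h)
    have hsurj : Function.Surjective g := by
      intro x
      obtain ⟨y, rfl⟩ := LinearMap.range_eq_top.1 hrange x
      obtain ⟨n, rfl⟩ := Nat.exists_eq_succ_of_ne_zero hn.ne'
      exact ⟨(g ^ n) y, by rw [Nat.succ_eq_add_one, pow_succ']; rfl⟩
    exact ⟨(LinearMap.injective_iff_surjective (f := g.restrictScalars ℂ)).2 hsurj, hsurj⟩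
  · left
    exact ⟨n, LinearMap.ker_eq_top.1 (key _ _ hcompl hker)⟩

variable (A) in
/-- A family of representatives of the simple modules, together with submodules of `A` which are
their projective covers. -/
structure SimpleSystem where
  ι : Type
  m : ι → Submodule A A
  P : ι → Submodule A A
  simple : ∀ i, IsSimpleModule A (A ⧸ m i)
  projective : ∀ i, Module.Projective A (P i)
  fitting : ∀ i, HasFitting A (P i)
  cover : ∀ i, ∃ f : P i →ₗ[A] A ⧸ m i, f ≠ 0
  complete : ∀ I : Submodule A A, IsSimpleModule A (A ⧸ I) → ∃ i, Nonempty ((A ⧸ I) ≃ₗ[A] A ⧸ m i)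
  eq_of_equiv : ∀ i j, Nonempty ((A ⧸ m i) ≃ₗ[A] A ⧸ m j) → i = j

variable (A) in
theorem nonempty_simpleSystem [Module.Finite ℂ A] : Nonempty (SimpleSystem A) := by
  let X := {I : Submodule A A // IsSimpleModule A (A ⧸ I)}
  let r : Setoid X := ⟨fun I J => Nonempty ((A ⧸ I.1) ≃ₗ[A] A ⧸ J.1),
    fun _ => ⟨LinearEquiv.refl _ _⟩, fun ⟨e⟩ => ⟨e.symm⟩, fun ⟨e⟩ ⟨f⟩ => ⟨e ≪≫ₗ f⟩⟩
  have hP : ∀ I : X, ∃ P : Submodule A A,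
      Module.Projective A P ∧ HasFitting A P ∧ ∃ f : P →ₗ[A] A ⧸ I.1, f ≠ 0 := by
    intro I
    have := I.2
    exact exists_hasFitting
  choose P h1 h2 h3 using hP
  refine ⟨⟨Quotient r, fun q => q.out.1, fun q => P q.out, fun q => q.out.2, fun q => h1 _,
    fun q => h2 _, fun q => h3 _, fun I hI => ⟨Quotient.mk r ⟨I, hI⟩, ?_⟩, fun q q' h => ?_⟩⟩
  · obtain ⟨e⟩ := Quotient.mk_out (s := r) ⟨I, hI⟩
    exact ⟨e.symm⟩
  · rw [← q.out_eq, ← q'.out_eq]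
    exact Quotient.sound h

namespace SimpleSystem
variable (S : SimpleSystem A)

instance (i : S.ι) : IsSimpleModule A (A ⧸ S.m i) := S.simple i
instance (i : S.ι) : Module.Projective A (S.P i) := S.projective i

/-- The dimension of the projective cover. -/
noncomputable def e (i : S.ι) : ℕ := Module.finrank ℂ (S.P i)

/-- The dimension of the simple module. -/
noncomputable def d (i : S.ι) : ℕ := Module.finrank ℂ (A ⧸ S.m i)

theorem exists_linearEquiv [IsSimpleModule A V] : ∃ i, Nonempty (V ≃ₗ[A] A ⧸ S.m i) := by
  obtain ⟨I, hI, ⟨e⟩⟩ := (isSimpleModule_iff_quot_maximal (R := A) (M := V)).1 inferInstance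
  obtain ⟨i, ⟨e'⟩⟩ := S.complete I (isSimpleModule_iff_isCoatom.2 hI.out)
  exact ⟨i, ⟨e ≪≫ₗ e'⟩⟩

variable (Q) in
/-- The multiplicity of a projective in another one. -/
noncomputable def mult (i : S.ι) : ℕ := Module.finrank ℂ (Q →ₗ[A] A ⧸ S.m i)

variable [Module.Finite ℂ A]

theorem finrank_hom_P [DecidableEq S.ι] (i j : S.ι) :
    Module.finrank ℂ (S.P i →ₗ[A] A ⧸ S.m j) = if i = j then 1 else 0 := by
  obtain ⟨f, hf⟩ := S.cover i
  split_ifs with h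
  · subst h
    exact (S.fitting i).finrank_hom_self hf
  · have : Subsingleton (S.P i →ₗ[A] A ⧸ S.m j) := by
      refine subsingleton_of_forall_eq 0 fun g => ?_
      by_contra hg
      obtain ⟨t, -⟩ := (S.fitting i).exists_comp_eq hf hg
      exact h (S.eq_of_equiv _ _ ⟨t⟩)
    exact Module.finrank_zero_of_subsingleton

theorem e_pos (i : S.ι) : 0 < S.e i := by
  obtain ⟨f, hf⟩ := S.cover i
  have : Nontrivial (S.P i) := by
    by_contra h
    rw [not_nontrivial_iff_subsingleton] at h
    exact hf (LinearMap.ext fun x => by rw [Subsingleton.elim x 0, map_zero, map_zero])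
  exact Module.finrank_pos

theorem exists_mult (n : ℕ) : ∀ (Q : Type) [AddCommGroup Q] [Module A Q] [Module ℂ Q]
    [IsScalarTower ℂ A Q] [Module.Finite ℂ Q] [Module.Projective A Q] (_ : Module.finrank ℂ Q = n),
    ∃ c : S.ι →₀ ℕ, (∀ i, S.mult Q i = c i) ∧
      Module.finrank ℂ Q = c.sum fun i a => a * S.e i := by
  classical
  induction n using Nat.strong_induction_on with
  | _ n ih =>
    intro Q _ _ _ _ _ _ hQ
    rcases subsingleton_or_nontrivial Q with hQ0 | hQ0
    · exact ⟨0, fun i => Module.finrank_zero_of_subsingleton, by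
        simpa using Module.finrank_zero_of_subsingleton⟩
    have hfin : Module.Finite A Q := Module.Finite.of_restrictScalars_finite ℂ A Q
    obtain ⟨M, hM, -⟩ := (eq_top_or_exists_le_coatom (⊥ : Submodule A Q)).resolve_left bot_ne_top
    have hs : IsSimpleModule A (Q ⧸ M) := isSimpleModule_iff_isCoatom.2 hM
    obtain ⟨i, ⟨t⟩⟩ := S.exists_linearEquiv (V := Q ⧸ M)
    obtain ⟨f, hf⟩ := S.cover i
    have hg : t.toLinearMap ∘ₗ M.mkQ ≠ 0 := by
      intro h
      have h2 : M.mkQ = 0 := LinearMap.ext fun x => t.injective (by simpa using LinearMap.congr_fun h x)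
      have h3 := Submodule.ker_mkQ M
      rw [h2, LinearMap.ker_zero] at h3
      exact hM.1 h3.symm
    obtain ⟨a, b, hab⟩ := (S.fitting i).exists_split hf hg
    have hab' : ∀ x, b (a x) = x := LinearMap.congr_fun hab
    let K := LinearMap.ker b
    let pr : Q →ₗ[A] K := (LinearMap.id - a ∘ₗ b).codRestrict K fun x => by
      simp [K, hab']
    let E : (S.P i × K) ≃ₗ[A] Q := LinearEquiv.ofLinearMap (a.coprod K.subtype) (b.prod pr)
      (by ext x; simp [pr])
      (by
        apply LinearMap.prod_ext
        · ext x <;> simp [pr, hab']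
        · ext x
          · simpa using x.2
          · have : b x = 0 := x.2
            simp [pr, this])
    have hK : Module.Projective A K := Module.Projective.of_split (K.subtype) pr
      (by
        ext x
        have : b x = 0 := x.2
        simp [pr, this])
    have hdim : Module.finrank ℂ Q = S.e i + Module.finrank ℂ K := by
      rw [← (E.restrictScalars ℂ).finrank_eq, Module.finrank_prod]
      rfl
    have hei := S.e_pos i
    obtain ⟨c, hc, hcd⟩ := ih _ (by omega) K rfl
    refine ⟨c + Finsupp.single i 1, fun j => ?_, ?_⟩
    · have hj : S.mult Q j = S.mult (S.P i × K) j :=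
        (E.congrLeft (A ⧸ S.m j) ℂ).symm.finrank_eq
      have hj2 : S.mult (S.P i × K) j = S.mult (S.P i) j + S.mult K j := by
        unfold mult
        rw [← (LinearMap.coprodEquiv (R := A) (M := S.P i) (M₂ := K) (M₃ := A ⧸ S.m j) ℂ).finrank_eq, Module.finrank_prod]
      rw [hj, hj2, hc, mult, S.finrank_hom_P]
      simp [Finsupp.single_apply, add_comm]
    · rw [Finsupp.sum_add_index' (by simp) (by intros; ring), ← hcd, hdim,
        Finsupp.sum_single_index (by simp), one_mul, add_comm]

variable [Module.Projective A Q] [Module.Finite ℂ Q]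

theorem d_pos (i : S.ι) : 0 < S.d i := by
  have := IsSimpleModule.nontrivial A (A ⧸ S.m i)
  exact Module.finrank_pos

theorem mult_self (i : S.ι) : S.mult A i = S.d i :=
  (LinearMap.ringLmapEquivSelf A ℂ (A ⧸ S.m i)).finrank_eq

instance finite_ι : Finite S.ι := by
  obtain ⟨c, hc, -⟩ := S.exists_mult _ A rfl
  refine Set.finite_univ_iff.1 (c.support.finite_toSet.subset fun i _ => ?_)
  rw [Finset.mem_coe, Finsupp.mem_support_iff, ← hc, mult_self]
  exact (S.d_pos i).ne'

theorem finrank_eq_sum [Fintype S.ι] : Module.finrank ℂ Q = ∑ i, S.mult Q i * S.e i := by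
  obtain ⟨c, hc, h⟩ := S.exists_mult _ Q rfl
  rw [h, Finsupp.sum_fintype _ _ (by simp)]
  simp [hc]

theorem finrank_self [Fintype S.ι] : Module.finrank ℂ A = ∑ i, S.d i * S.e i := by
  rw [S.finrank_eq_sum]
  simp [mult_self]

end SimpleSystem
end FiniteDim

section Twist
variable {A : Type} [Ring A] [Algebra ℂ A]
variable {P P' V V' M N L : Type} [AddCommGroup P] [Module A P] [Module ℂ P] [IsScalarTower ℂ A P]
  [AddCommGroup P'] [Module A P'] [Module ℂ P'] [IsScalarTower ℂ A P']
  [AddCommGroup V] [Module A V] [Module ℂ V] [IsScalarTower ℂ A V]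
  [AddCommGroup V'] [Module A V'] [Module ℂ V'] [IsScalarTower ℂ A V']
  [AddCommGroup M] [Module A M] [Module ℂ M] [IsScalarTower ℂ A M]
  [AddCommGroup N] [Module A N] [Module ℂ N] [IsScalarTower ℂ A N]
  [AddCommGroup L] [Module A L] [Module ℂ L] [IsScalarTower ℂ A L]

variable (M) in
/-- The module `M` with `A` acting through the automorphism `φ`. -/
abbrev Twist (φ : A ≃ₐ[ℂ] A) : Type :=
  RepMod ((Algebra.lsmul ℂ ℂ M : A →ₐ[ℂ] Module.End ℂ M).comp φ.toAlgHom)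

namespace Twist
variable (M) (φ : A ≃ₐ[ℂ] A)

/-- The identity map, from a module to its twist. -/
noncomputable def of : M ≃ₗ[ℂ] Twist M φ := RepMod.of _

variable {M}

theorem of_smul (x : A) (m : M) : of M φ (φ x • m) = x • of M φ m := rfl

end Twist

variable (M N) in
/-- `M` and `N` are isomorphic up to the automorphism `φ`. -/
def TwIso (φ : A ≃ₐ[ℂ] A) : Prop := ∃ f : M ≃ₗ[ℂ] N, ∀ (x : A) (m : M), f (x • m) = φ x • f m

variable {φ ψ : A ≃ₐ[ℂ] A}

theorem TwIso.of_linearEquiv (f : M ≃ₗ[A] N) : TwIso M N (1 : A ≃ₐ[ℂ] A) :=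
  ⟨f.restrictScalars ℂ, fun x m => f.map_smul x m⟩

theorem TwIso.symm (h : TwIso M N φ) : TwIso N M φ⁻¹ := by
  obtain ⟨f, hf⟩ := h
  refine ⟨f.symm, fun x n => ?_⟩
  rw [LinearEquiv.symm_apply_eq, hf, LinearEquiv.apply_symm_apply]
  congr 1
  exact (φ.apply_symm_apply x).symm

theorem TwIso.trans (h : TwIso M N φ) (h' : TwIso N L ψ) : TwIso M L (ψ * φ) := by
  obtain ⟨f, hf⟩ := h
  obtain ⟨g, hg⟩ := h'
  exact ⟨f ≪≫ₗ g, fun x m => by simp [hf, hg]⟩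

theorem TwIso.nonempty_linearEquiv (h : TwIso M N (1 : A ≃ₐ[ℂ] A)) : Nonempty (M ≃ₗ[A] N) := by
  obtain ⟨f, hf⟩ := h
  exact ⟨{ f with map_smul' := hf }⟩

theorem TwIso.finrank_eq (h : TwIso M N φ) : Module.finrank ℂ M = Module.finrank ℂ N := by
  obtain ⟨f, -⟩ := h
  exact f.finrank_eq

/-- Isomorphism with a twist, as a semilinear equivalence. -/
theorem twIso_twist (φ : A ≃ₐ[ℂ] A) : TwIso M (Twist M φ) φ⁻¹ :=
  ⟨Twist.of M φ, fun x m => by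
    rw [← Twist.of_smul]
    congr 2
    exact (φ.apply_symm_apply x).symm⟩

theorem twIso_inner (u : Aˣ) (hφ : ∀ x, φ x * u = u * x) : TwIso M M φ := by
  refine ⟨LinearEquiv.ofLinearMap (Algebra.lsmul ℂ ℂ M (u : A)) (Algebra.lsmul ℂ ℂ M (↑u⁻¹ : A)) ?_ ?_, ?_⟩
  · ext m; simp [← mul_smul]
  · ext m; simp [← mul_smul]
  · intro x m
    simp [← mul_smul, hφ]

theorem TwIso.isSimpleModule [IsSimpleModule A M] (h : TwIso M N φ) : IsSimpleModule A N := by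
  obtain ⟨f, hf⟩ := h
  let g : M →ₛₗ[(φ : A →+* A)] N := { f with map_smul' := hf }
  have : RingHomSurjective (φ : A →+* A) := ⟨φ.surjective⟩
  exact (LinearMap.isSimpleModule_iff_of_bijective g f.bijective).1 inferInstance

theorem exists_twisted_lift [Module.Projective A P] (φ : A ≃ₐ[ℂ] A) {F : P' →ₗ[A] V'}
    (hF : Function.Surjective F) (u : P →ₗ[ℂ] V') (hu : ∀ (x : A) p, u (x • p) = φ x • u p) :
    ∃ g : P →ₗ[ℂ] P', (∀ (x : A) p, g (x • p) = φ x • g p) ∧ ∀ p, F (g p) = u p := by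
  let F' : Twist P' φ →ₗ[A] Twist V' φ :=
    { (Twist.of V' φ).toLinearMap ∘ₗ F.restrictScalars ℂ ∘ₗ (Twist.of P' φ).symm.toLinearMap with
      map_smul' x m := by
        obtain ⟨m, rfl⟩ := (Twist.of P' φ).surjective m
        simp [← Twist.of_smul] }
  let u' : P →ₗ[A] Twist V' φ :=
    { (Twist.of V' φ).toLinearMap ∘ₗ u with
      map_smul' x m := by simp [← Twist.of_smul, hu] }
  obtain ⟨g, hg⟩ := Module.projective_lifting_property F' u' hF
  refine ⟨(Twist.of P' φ).symm.toLinearMap ∘ₗ g.restrictScalars ℂ, fun x p => ?_, fun p =>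
    LinearMap.congr_fun hg p⟩
  simp only [LinearMap.comp_apply, LinearMap.restrictScalars_apply, map_smul, LinearEquiv.coe_coe]
  rw [LinearEquiv.symm_apply_eq, Twist.of_smul, LinearEquiv.apply_symm_apply]

theorem TwIso.lift [Module.Projective A P] [Module.Projective A P'] (hP : HasFitting A P)
    (hP' : HasFitting A P') [IsSimpleModule A V] [IsSimpleModule A V'] {f : P →ₗ[A] V} (hf : f ≠ 0)
    {f' : P' →ₗ[A] V'} (hf' : f' ≠ 0) (h : TwIso V V' φ) : TwIso P P' φ := by
  have h' := h
  obtain ⟨t, ht⟩ := h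
  have ht' : ∀ (x : A) v, t.symm (x • v) = φ.symm x • t.symm v := by
    intro x v
    rw [LinearEquiv.symm_apply_eq, ht, AlgEquiv.apply_symm_apply, LinearEquiv.apply_symm_apply]
  obtain ⟨g, hg, hgf⟩ := exists_twisted_lift (P := P) φ (LinearMap.surjective_of_ne_zero hf')
    (t.toLinearMap ∘ₗ f.restrictScalars ℂ) (by simp [ht])
  obtain ⟨g', hg', hgf'⟩ := exists_twisted_lift (P := P') φ.symm (LinearMap.surjective_of_ne_zero hf)
    (t.symm.toLinearMap ∘ₗ f'.restrictScalars ℂ) (by simp [ht'])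
  have h1 : Function.Bijective (g' ∘ g) := by
    let c : Module.End A P := { g' ∘ₗ g with map_smul' x m := by simp [hg, hg'] }
    exact hP.bijective (g := c) hf (by ext p; simp [c, hgf, hgf'])
  have h2 : Function.Bijective (g ∘ g') := by
    let c : Module.End A P' := { g ∘ₗ g' with map_smul' x m := by simp [hg, hg'] }
    exact hP'.bijective (g := c) hf' (by ext p; simp [c, hgf, hgf'])
  exact ⟨LinearEquiv.ofBijective g ⟨h1.1.of_comp, h2.2.of_comp⟩, hg⟩

theorem TwIso.finrank_hom_eq (h : TwIso P P' φ) (h' : TwIso V V' φ) :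
    Module.finrank ℂ (P →ₗ[A] V) = Module.finrank ℂ (P' →ₗ[A] V') := by
  obtain ⟨f, hf⟩ := h
  obtain ⟨g, hg⟩ := h'
  have hf' : ∀ (x : A) v, f.symm (x • v) = φ.symm x • f.symm v := by
    intro x v
    rw [LinearEquiv.symm_apply_eq, hf, AlgEquiv.apply_symm_apply, LinearEquiv.apply_symm_apply]
  have hg' : ∀ (x : A) v, g.symm (x • v) = φ.symm x • g.symm v := by
    intro x v
    rw [LinearEquiv.symm_apply_eq, hg, AlgEquiv.apply_symm_apply, LinearEquiv.apply_symm_apply]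
  let E : (P →ₗ[A] V) ≃ₗ[ℂ] (P' →ₗ[A] V') :=
    { toFun u := { g.toLinearMap ∘ₗ u.restrictScalars ℂ ∘ₗ f.symm.toLinearMap with
        map_smul' x m := by simp [hf', hg] }
      invFun u := { g.symm.toLinearMap ∘ₗ u.restrictScalars ℂ ∘ₗ f.toLinearMap with
        map_smul' x m := by simp [hf, hg'] }
      map_add' u v := by ext; simp; rfl
      map_smul' c u := by ext; simp; rfl
      left_inv u := LinearMap.ext fun x => by
        change g.symm (g (u (f.symm (f x)))) = u x
        simp
      right_inv u := LinearMap.ext fun x => by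
        change g (g.symm (u (f (f.symm x)))) = u x
        simp }
  exact E.finrank_eq

namespace SimpleSystem
variable (S : SimpleSystem A)

theorem exists_twIso (φ : A ≃ₐ[ℂ] A) (i : S.ι) : ∃ j, TwIso (A ⧸ S.m i) (A ⧸ S.m j) φ := by
  have h : TwIso (A ⧸ S.m i) (Twist (A ⧸ S.m i) φ⁻¹) φ := by
    simpa using twIso_twist (M := A ⧸ S.m i) φ⁻¹
  have := h.isSimpleModule
  obtain ⟨j, ⟨e⟩⟩ := S.exists_linearEquiv (V := Twist (A ⧸ S.m i) φ⁻¹)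
  exact ⟨j, by simpa using h.trans (TwIso.of_linearEquiv e)⟩

/-- The action of an automorphism on the simple modules. -/
noncomputable def permFun (φ : A ≃ₐ[ℂ] A) (i : S.ι) : S.ι := (S.exists_twIso φ i).choose

theorem twIso_permFun (φ : A ≃ₐ[ℂ] A) (i : S.ι) :
    TwIso (A ⧸ S.m i) (A ⧸ S.m (S.permFun φ i)) φ := (S.exists_twIso φ i).choose_spec

theorem permFun_eq {φ : A ≃ₐ[ℂ] A} {i j : S.ι} (h : TwIso (A ⧸ S.m i) (A ⧸ S.m j) φ) :
    S.permFun φ i = j := by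
  refine S.eq_of_equiv _ _ (TwIso.nonempty_linearEquiv ?_)
  simpa using (S.twIso_permFun φ i).symm.trans h

/-- The action of automorphisms on the simple modules. -/
noncomputable def perm : (A ≃ₐ[ℂ] A) →* Equiv.Perm S.ι :=
  letI : MulAction (A ≃ₐ[ℂ] A) S.ι :=
    { smul := S.permFun
      one_smul i := S.permFun_eq (TwIso.of_linearEquiv (LinearEquiv.refl _ _))
      mul_smul φ ψ i := S.permFun_eq ((S.twIso_permFun ψ i).trans (S.twIso_permFun φ _)) }
  MulAction.toPermHom _ _

theorem twIso_perm (φ : A ≃ₐ[ℂ] A) (i : S.ι) :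
    TwIso (A ⧸ S.m i) (A ⧸ S.m (S.perm φ i)) φ := S.twIso_permFun φ i

theorem perm_eq {φ : A ≃ₐ[ℂ] A} {i j : S.ι} (h : TwIso (A ⧸ S.m i) (A ⧸ S.m j) φ) :
    S.perm φ i = j := S.permFun_eq h

theorem twIso_P (φ : A ≃ₐ[ℂ] A) (i : S.ι) : TwIso (S.P i) (S.P (S.perm φ i)) φ := by
  obtain ⟨f, hf⟩ := S.cover i
  obtain ⟨f', hf'⟩ := S.cover (S.perm φ i)
  exact (S.twIso_perm φ i).lift (S.fitting _) (S.fitting _) hf hf'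

theorem d_perm (φ : A ≃ₐ[ℂ] A) (i : S.ι) : S.d (S.perm φ i) = S.d i :=
  (S.twIso_perm φ i).finrank_eq.symm

theorem e_perm (φ : A ≃ₐ[ℂ] A) (i : S.ι) : S.e (S.perm φ i) = S.e i :=
  (S.twIso_P φ i).finrank_eq.symm

theorem mult_perm {φ : A ≃ₐ[ℂ] A} (h : TwIso M M φ) (i : S.ι) :
    S.mult M (S.perm φ i) = S.mult M i :=
  (h.finrank_hom_eq (S.twIso_perm φ i)).symm

theorem perm_eq_of_inner {φ ψ : A ≃ₐ[ℂ] A} (u : Aˣ) (h : ∀ x, φ x * u = u * ψ x) :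
    S.perm φ = S.perm ψ := by
  have h1 : S.perm (φ * ψ⁻¹) = 1 := Equiv.ext fun i => S.perm_eq (twIso_inner u fun x => by
    have := h (ψ.symm x)
    rwa [ψ.apply_symm_apply] at this)
  rwa [map_mul, map_inv, mul_inv_eq_one] at h1

end SimpleSystem
end Twist

section Counting
variable {ι : Type} [Fintype ι]

theorem exists_fixed_odd {τ : Equiv.Perm ι} (hτ : ∀ i, τ (τ i) = i) {w : ι → ℕ}
    (hw : ∀ i, w (τ i) = w i) (h : Odd (∑ i, w i)) : ∃ i, τ i = i ∧ Odd (w i) := by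
  by_contra! hcon
  have key : (∑ i, (w i : ZMod 2)) = 0 := by
    refine Finset.sum_involution (fun i _ => τ i) (fun i _ => ?_) (fun i _ h0 hi => ?_)
      (fun i _ => Finset.mem_univ _) (fun i _ => hτ i)
    · rw [hw]
      exact CharTwo.add_self_eq_zero _
    · exact h0 ((ZMod.natCast_eq_zero_iff_even).2 (Nat.not_odd_iff_even.1 (hcon i hi)))
  rw [← Nat.cast_sum, ZMod.natCast_eq_zero_iff_even] at key
  exact Nat.not_even_iff_odd.2 h key

theorem card_mul_le_sum {κ : Type} [Fintype κ] {f : κ → ι} (hf : Function.Injective f) {w : ι → ℕ}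
    {c : ℕ} (hw : ∀ k, w (f k) = c) : Fintype.card κ * c ≤ ∑ i, w i := by
  classical
  calc Fintype.card κ * c = ∑ k, w (f k) := by simp [hw]
    _ = ∑ i ∈ Finset.univ.map ⟨f, hf⟩, w i := by simp
    _ ≤ ∑ i, w i := Finset.sum_le_sum_of_subset (Finset.subset_univ _)

variable {w : ι → ℕ} {n : ℕ} {i : ι}

theorem Equiv.Perm.pow_invariant {ρ : Equiv.Perm ι} (hw : ∀ j, w (ρ j) = w j) (n : ℕ) (j : ι) :
    w ((ρ ^ n) j) = w j := by
  induction n with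
  | zero => rfl
  | succ n ih => rw [pow_succ', Equiv.Perm.mul_apply, hw, ih]

theorem Equiv.Perm.zpow_fixed {ρ : Equiv.Perm ι} (h : ρ i = i) (n : ℤ) : (ρ ^ n) i = i :=
  zpow_mem (K := MulAction.stabilizer (Equiv.Perm ι) i) h n

theorem Equiv.Perm.eq_of_pow_fixed {ρ : Equiv.Perm ι} (hn : n.Prime) (hρ : ρ ^ n = 1) {x : ℤ}
    (hx : ¬ (n : ℤ) ∣ x) : ∃ u : ℤ, ρ ^ (x * u) = ρ := by
  have hg : IsCoprime (n : ℤ) x := (Nat.prime_iff_prime_int.1 hn).coprime_iff_not_dvd.2 hx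
  obtain ⟨v, u, h⟩ := hg
  refine ⟨u, ?_⟩
  have : x * u = 1 - n * v := by linarith
  rw [this, zpow_sub, zpow_one, zpow_mul, zpow_natCast, hρ, one_zpow, inv_one, mul_one]

theorem mul_le_sum_of_orbit {ρ : Equiv.Perm ι} (h : ∀ x : ℤ, (ρ ^ x) i = i → (n : ℤ) ∣ x)
    (hw : ∀ j, w (ρ j) = w j) : n * w i ≤ ∑ j, w j := by
  have := card_mul_le_sum (f := fun k : Fin n => (ρ ^ (k : ℕ)) i) (w := w) (c := w i)
    (fun a b hab => ?_) fun k => Equiv.Perm.pow_invariant hw _ _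
  · simpa using this
  · have h1 := h (-(b : ℕ) + (a : ℕ)) (by
      rw [zpow_add, zpow_neg, Equiv.Perm.mul_apply, Equiv.Perm.inv_eq_iff_eq, zpow_natCast,
        zpow_natCast]
      exact hab)
    have h2 := Int.eq_zero_of_abs_lt_dvd h1 (by rw [abs_lt]; omega)
    exact Fin.ext (by omega)

theorem Equiv.Perm.dvd_of_zpow_fixed {ρ : Equiv.Perm ι} (hn : n.Prime) (hρ : (ρ ^ n) i = i)
    (hi : ρ i ≠ i) (x : ℤ) (hx : (ρ ^ x) i = i) : (n : ℤ) ∣ x := by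
  by_contra hd
  obtain ⟨v, u, h⟩ := (Nat.prime_iff_prime_int.1 hn).coprime_iff_not_dvd.2 hd
  apply hi
  have hv : ((ρ ^ n) ^ v) i = i := zpow_fixed hρ v
  have hu : ((ρ ^ x) ^ u) i = i := zpow_fixed hx u
  nth_rewrite 2 [← hv]
  nth_rewrite 2 [← hu]
  rw [← zpow_natCast, ← zpow_mul, ← zpow_mul, ← Equiv.Perm.mul_apply, ← zpow_add,
    show (n : ℤ) * v + x * u = 1 by linarith, zpow_one]

/-- Orbits of two commuting permutations of prime order `n`: either all the translates of `i` are
different, or one of the permutations moves `i` inside the orbit of the other. -/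
theorem orbit_dichotomy {L R : Equiv.Perm ι} (hn : n.Prime) (hLR : Commute L R) (hL : L ^ n = 1)
    (hR : R ^ n = 1) (hwL : ∀ j, w (L j) = w j) (hwR : ∀ j, w (R j) = w j) (i : ι) :
    n * n * w i ≤ ∑ j, w j ∨ (∃ c : ℤ, L i = (R ^ c) i) ∨ R i = i := by
  by_cases hinj : Function.Injective fun k : Fin n × Fin n => (L ^ (k.1 : ℕ)) ((R ^ (k.2 : ℕ)) i)
  · left
    simpa using card_mul_le_sum hinj (w := w) (c := w i) fun k => by
      rw [Equiv.Perm.pow_invariant hwL, Equiv.Perm.pow_invariant hwR]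
  right
  simp only [Function.Injective, not_forall] at hinj
  obtain ⟨⟨a, b⟩, ⟨a', b'⟩, hab, hne⟩ := hinj
  let x : ℤ := -(a' : ℕ) + (a : ℕ)
  let y : ℤ := -(b' : ℕ) + (b : ℕ)
  have hxy : (L ^ x * R ^ y) i = i := by
    have : L ^ x * R ^ y = (L ^ (a' : ℕ) * R ^ (b' : ℕ))⁻¹ * (L ^ (a : ℕ) * R ^ (b : ℕ)) := by
      have h1 := (hLR.zpow_zpow (a : ℕ) (-(b' : ℕ))).eq
      rw [zpow_add, zpow_add, mul_inv_rev, mul_assoc, ← mul_assoc (L ^ ((a : ℕ) : ℤ)), h1,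
        ← mul_assoc, ← mul_assoc, (hLR.zpow_zpow (-(a' : ℕ)) (-(b' : ℕ))).eq]
      simp [mul_assoc]
    rw [this, Equiv.Perm.mul_apply, Equiv.Perm.inv_eq_iff_eq]
    exact hab
  have hpow : ∀ u : ℤ, (L ^ (x * u) * R ^ (y * u)) i = i := by
    intro u
    rw [zpow_mul, zpow_mul, ← ((hLR.zpow_zpow x y)).mul_zpow]
    exact Equiv.Perm.zpow_fixed hxy u
  by_cases hx : (n : ℤ) ∣ x
  · right
    by_contra hi
    have hx0 : x = 0 := Int.eq_zero_of_abs_lt_dvd hx (by rw [abs_lt]; omega)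
    rw [hx0, zpow_zero, one_mul] at hxy
    have hy0 : y = 0 := Int.eq_zero_of_abs_lt_dvd
      (Equiv.Perm.dvd_of_zpow_fixed hn (by rw [hR]; rfl) hi y hxy) (by rw [abs_lt]; omega)
    have ha : a = a' := Fin.ext (by omega)
    have hb : b = b' := Fin.ext (by omega)
    exact hne (by rw [ha, hb])
  · left
    obtain ⟨u, hu⟩ := Equiv.Perm.eq_of_pow_fixed hn hL hx
    refine ⟨-(y * u), ?_⟩
    have := hpow u
    rw [hu, (hLR.zpow_right _).eq, Equiv.Perm.mul_apply] at this
    rw [zpow_neg, Equiv.Perm.eq_inv_iff_eq, this]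

theorem orbit_trichotomy {s L R : Equiv.Perm ι} (hn : n.Prime) (hodd : Odd n) (hsL : Commute s L)
    (hs : R = s * s * L) (hL : L ^ n = 1) (hR : R ^ n = 1) (hwL : ∀ j, w (L j) = w j)
    (hwR : ∀ j, w (R j) = w j) {i : ι} (hi : (s ^ n) i = i) (hsi : s i ≠ i) :
    n * n * w i ≤ ∑ j, w j ∨ (∃ c : ℤ, s i = (R ^ c) i ∧ R i ≠ i) ∨
      ∃ c : ℤ, s i = (L ^ c) i ∧ L i ≠ i := by
  have hLR : Commute L R := by
    rw [hs]
    exact ((hsL.symm.mul_right hsL.symm)).mul_right (Commute.refl L)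
  obtain ⟨m, hm⟩ := hodd
  have hsm : s i = (R ^ ((m : ℤ) + 1) * L ^ (-((m : ℤ) + 1))) i := by
    have h1 : R * L⁻¹ = s * s := by rw [hs, mul_inv_cancel_right]
    rw [zpow_neg, ← inv_zpow, ← (hLR.symm.inv_right).mul_zpow, h1]
    have h2 : (s * s) ^ ((m : ℤ) + 1) = s * s ^ n := by
      rw [← pow_succ', hm]
      have : (m : ℤ) + 1 = (m + 1 : ℕ) := by push_cast; ring
      rw [this, zpow_natCast, ← pow_two, ← pow_mul]
      congr 1
    rw [h2, Equiv.Perm.mul_apply, hi]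
  rcases orbit_dichotomy hn hLR hL hR hwL hwR i with h | ⟨c, hc⟩ | h
  · exact .inl h
  · right; left
    have hLc : (L ^ (-((m : ℤ) + 1))) i = (R ^ (c * (-((m : ℤ) + 1)))) i := by
      have h1 : (R ^ (-c) * L) i = i := by
        rw [Equiv.Perm.mul_apply, zpow_neg, Equiv.Perm.inv_eq_iff_eq, hc]
      have h2 := Equiv.Perm.zpow_fixed h1 (-((m : ℤ) + 1))
      rw [(hLR.symm.zpow_left (-c)).mul_zpow, ← zpow_mul, neg_mul, zpow_neg, Equiv.Perm.mul_apply,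
        Equiv.Perm.inv_eq_iff_eq] at h2
      exact h2
    have hsc : s i = (R ^ ((m : ℤ) + 1 + c * (-((m : ℤ) + 1)))) i := by
      rw [hsm, Equiv.Perm.mul_apply, hLc, ← Equiv.Perm.mul_apply, ← zpow_add]
    exact ⟨_, hsc, fun h => hsi (hsc.trans (Equiv.Perm.zpow_fixed h _))⟩
  · right; right
    have hsc : s i = (L ^ (-((m : ℤ) + 1))) i := by
      rw [hsm, (hLR.symm.zpow_zpow _ _).eq, Equiv.Perm.mul_apply, Equiv.Perm.zpow_fixed h]
    exact ⟨_, hsc, fun h => hsi (hsc.trans (Equiv.Perm.zpow_fixed h _))⟩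

end Counting

section Hopf
variable {H : Type} [Ring H] [HopfAlgebra ℂ H]
open HopfAlgebra Coalgebra

theorem TwIso.projective {P M : Type} [AddCommGroup P] [Module H P] [Module ℂ P]
    [AddCommGroup M] [Module H M] [Module ℂ M] [Module.Projective H P] {φ : H ≃ₐ[ℂ] H}
    (h : TwIso P M φ) : Module.Projective H M := by
  obtain ⟨f, hf⟩ := h
  let _ := RingHomInvPair.of_ringEquiv φ.toRingEquiv
  let _ := RingHomInvPair.of_ringEquiv φ.toRingEquiv.symm
  let g : P ≃ₛₗ[(φ.toRingEquiv : H →+* H)] M := { f with map_smul' := hf }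
  exact Module.Projective.of_equiv g

section Tensor
variable {P V W : Type} [AddCommGroup P] [Module H P] [Module ℂ P] [IsScalarTower ℂ H P]
  [AddCommGroup V] [Module H V] [Module ℂ V] [IsScalarTower ℂ H V]
  [AddCommGroup W] [Module H W] [Module ℂ W] [IsScalarTower ℂ H W]
  {δ : H →ₐ[ℂ] H ⊗[ℂ] H} {φ ψ ψ' : H ≃ₐ[ℂ] H}

theorem TwIso.tMod (hδ : ∀ x, δ (φ x) = TensorProduct.map ψ.toLinearMap ψ'.toLinearMap (δ x))
    (hP : TwIso P P ψ) (hW : TwIso W W ψ') : TwIso (TMod P W δ) (TMod P W δ) φ := by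
  obtain ⟨f, hf⟩ := hP
  obtain ⟨g, hg⟩ := hW
  let o := RepMod.of ((tensorAct ℂ H P W).comp δ)
  refine ⟨o.symm ≪≫ₗ TensorProduct.congr f g ≪≫ₗ o, fun x m => ?_⟩
  obtain ⟨m, rfl⟩ := o.surjective m
  have key : ∀ t : H ⊗[ℂ] H, TensorProduct.congr f g (tensorAct ℂ H P W t m) =
      tensorAct ℂ H P W (TensorProduct.map ψ.toLinearMap ψ'.toLinearMap t)
        (TensorProduct.congr f g m) := by
    intro t
    induction t with
    | zero => simp
    | add x y hx hy => simp only [map_add, LinearMap.add_apply, hx, hy]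
    | tmul a b =>
      induction m with
      | zero => simp
      | add x y hx hy => simp only [map_add, hx, hy]
      | tmul p w => simp [hf, hg]
  simp only [o, RepMod.smul_of, LinearEquiv.trans_apply, LinearEquiv.symm_apply_apply,
    AlgHom.comp_apply, key, hδ]

theorem TwIso.dual {T : H →ₗ[ℂ] H} (h1 : T 1 = 1) (h : ∀ x y, T (x * y) = T y * T x)
    (hT : ∀ x, T (ψ' x) = ψ (T x)) (hV : TwIso V V ψ) :
    TwIso (RepMod (dualRep V T h1 h)) (RepMod (dualRep V T h1 h)) ψ' := by
  obtain ⟨f, hf⟩ := hV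
  let o := RepMod.of (dualRep V T h1 h)
  refine ⟨o.symm ≪≫ₗ f.symm.dualMap ≪≫ₗ o, fun x m => ?_⟩
  obtain ⟨m, rfl⟩ := o.surjective m
  simp only [o, RepMod.smul_of, LinearEquiv.trans_apply, LinearEquiv.symm_apply_apply]
  congr 1
  ext v
  simp only [LinearEquiv.dualMap_apply, dualRep_apply, hT]
  congr 1
  rw [LinearEquiv.eq_symm_apply, hf, LinearEquiv.apply_symm_apply]

theorem finrank_tMod : Module.finrank ℂ (TMod P W δ) = Module.finrank ℂ P * Module.finrank ℂ W :=
  Module.finrank_tensorProduct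

end Tensor


theorem isSemisimpleRing_of_projective
    (h : ∀ I : Submodule H H, Module.Projective H (H ⧸ I)) : IsSemisimpleRing H := by
  refine { exists_isCompl I := ?_ }
  have := h I
  obtain ⟨s, hs⟩ := Module.projective_lifting_property I.mkQ LinearMap.id I.mkQ_surjective
  have hs' : ∀ x, I.mkQ (s x) = x := LinearMap.congr_fun hs
  let f : H →ₗ[H] I := (LinearMap.id - s ∘ₗ I.mkQ).codRestrict I fun x => by
    refine (Submodule.Quotient.mk_eq_zero I).1 (show I.mkQ _ = 0 from ?_)
    simp only [LinearMap.sub_apply, map_sub, LinearMap.comp_apply, hs', LinearMap.id_apply, sub_self]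
  refine ⟨_, LinearMap.isCompl_of_proj (f := f) fun x => Subtype.ext ?_⟩
  simp [f, (Submodule.Quotient.mk_eq_zero I).2 x.2]

theorem isSemisimpleRing_of_finrank_eq_one {P : Type} [AddCommGroup P] [Module H P] [Module ℂ P]
    [IsScalarTower ℂ H P] [Module.Projective H P] (hP : Module.finrank ℂ P = 1) :
    IsSemisimpleRing H := by
  refine isSemisimpleRing_of_projective fun I => ?_
  have := isSimpleModule_iff_finrank_eq_one.2 hP
  let E : ℂ ≃ₐ[ℂ] Module.End ℂ P := AlgEquiv.ofBijective (Algebra.ofId ℂ _)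
    (IsSimpleModule.algebraMap_end_bijective_of_isAlgClosed (A := ℂ) (V := P) ℂ)
  let χ : H →ₐ[ℂ] ℂ := E.symm.toAlgHom.comp (Algebra.lsmul ℂ ℂ P)
  have hχ : ∀ (x : H) (p : P), x • p = χ x • p := fun x p =>
    (LinearMap.congr_fun (E.apply_symm_apply (Algebra.lsmul ℂ ℂ P x)) p).symm
  obtain ⟨p, hp⟩ := Module.finrank_pos_iff_exists_ne_zero.1 (hP.symm ▸ one_pos)
  let M := H ⧸ I
  let δ := Bialgebra.comulAlgHom ℂ H
  let g : M ≃ₗ[ℂ] P ⊗[ℂ] M := (TensorProduct.lid ℂ M).symm ≪≫ₗ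
    TensorProduct.congr (LinearEquiv.toSpanNonzeroSingleton ℂ P p hp ≪≫ₗ
      LinearEquiv.ofTop _ ((finrank_eq_one_iff_of_nonzero p hp).1 hP)) (LinearEquiv.refl ℂ M)
  have hg : ∀ m, g m = p ⊗ₜ m := fun m => by simp [g]
  have htw : TwIso (TMod P M δ) M (lAut χ) := by
    let o := RepMod.of ((tensorAct ℂ H P M).comp δ)
    refine ⟨o.symm ≪≫ₗ g.symm, fun x m => ?_⟩
    obtain ⟨m, rfl⟩ := o.surjective m
    obtain ⟨m, rfl⟩ := g.surjective m
    simp only [o, RepMod.smul_of, LinearEquiv.trans_apply, LinearEquiv.symm_apply_apply]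
    rw [LinearEquiv.symm_apply_eq, hg, hg, lAut_apply, lOp_apply]
    change tensorAct ℂ H P M (comul x) (p ⊗ₜ m) = _
    induction comul (R := ℂ) x with
    | zero => simp
    | add x y hx hy => simp only [map_add, LinearMap.add_apply, hx, hy, add_smul, TensorProduct.tmul_add]
    | tmul a b => simp [hχ, TensorProduct.smul_tmul]
  have hproj : Module.Projective H (TMod P M δ) := projective_tMod isDiagonal_comul
  exact htw.projective

variable [Module.Finite ℂ H]

namespace SimpleSystem
variable (S : SimpleSystem H)

theorem orderOf_l_mul_le [Fintype S.ι] (D : RadfordSystem ℂ H) :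
    ∃ i, orderOf D.l * (S.d i * S.e i) ≤ Module.finrank ℂ H := by
  let W := RepMod ((Algebra.lsmul ℂ ℂ ℂ).comp (Bialgebra.counitAlgHom ℂ H))
  let o : ℂ ≃ₗ[ℂ] W := RepMod.of _
  have ho : ∀ (x : H) z, x • o z = o (counit (R := ℂ) x * z) := fun x z => rfl
  have hW : IsSimpleModule H W := by
    have : Nontrivial W := o.symm.toEquiv.nontrivial
    refine isSimpleModule_iff_toSpanSingleton_surjective.2 ⟨this, fun m hm y => ?_⟩
    obtain ⟨m, rfl⟩ := o.surjective m
    obtain ⟨y, rfl⟩ := o.surjective y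
    have hm0 : m ≠ 0 := fun h => hm (by rw [h, map_zero])
    refine ⟨algebraMap ℂ H (y / m), ?_⟩
    simp [ho, hm0]
  obtain ⟨i, ⟨t⟩⟩ := S.exists_linearEquiv (V := W)
  refine ⟨i, ?_⟩
  rw [S.finrank_self]
  refine mul_le_sum_of_orbit (ρ := S.perm D.l) (w := fun i => S.d i * S.e i) (fun x hx => ?_)
    fun j => by rw [d_perm, e_perm]
  rw [orderOf_dvd_iff_zpow_eq_one]
  refine D.l_zpow_eq_one fun y => ?_
  rw [← map_zpow] at hx
  have h1 := S.twIso_perm (D.l ^ x) i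
  rw [hx] at h1
  have h2 := ((TwIso.of_linearEquiv t).trans h1).trans (TwIso.of_linearEquiv t.symm)
  rw [one_mul, mul_one] at h2
  obtain ⟨f, hf⟩ := h2
  obtain ⟨z, hz⟩ := o.surjective (f (o 1))
  have h3 := hf y (o 1)
  rw [← hz, ho, ho, mul_one] at h3
  have h4 : o (counit (R := ℂ) y) = counit (R := ℂ) y • o 1 := by rw [← map_smul]; simp
  rw [h4, map_smul, ← hz, ← map_smul] at h3
  have h5 := o.injective h3
  have hz0 : z ≠ 0 := by
    rintro rfl
    rw [map_zero, eq_comm, LinearEquiv.map_eq_zero_iff, LinearEquiv.map_eq_zero_iff] at hz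
    exact one_ne_zero hz
  exact (mul_right_cancel₀ hz0 h5).symm

theorem exists_fixed_of_twisted [Fintype S.ι] {δ : H →ₐ[ℂ] H ⊗[ℂ] H} {T : H →ₗ[ℂ] H}
    (hδ : IsDiagonal δ T) (h1 : T 1 = 1) {φ ψ ψ' : H ≃ₐ[ℂ] H}
    (hT : ∀ x, T (ψ' x) = ψ (T x))
    (hψ : ∀ x, δ (φ x) = TensorProduct.map ψ.toLinearMap ψ'.toLinearMap (δ x))
    {i : S.ι} (hi : S.perm ψ i = i) (hodd : Odd (S.d i * S.e i)) {n N : ℕ} (hn : n.Prime)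
    (hφ : S.perm φ ^ (n + n) = 1) (hbound : n * (S.d i * S.e i) ≤ N)
    (hkey : ∀ j, Odd (S.e j) → N < n * n * S.e j) : ∃ j, S.perm φ j = j ∧ Odd (S.e j) := by
  let V := H ⧸ S.m i
  let W := RepMod (dualRep V T h1 hδ.map_mul)
  let Q := TMod (S.P i) W δ
  have hV : TwIso V V ψ := by
    have h := S.twIso_perm ψ i
    rwa [hi] at h
  have hP : TwIso (S.P i) (S.P i) ψ := by
    have h := S.twIso_P ψ i
    rwa [hi] at h
  have hQ : TwIso Q Q φ := TwIso.tMod hψ hP (hV.dual h1 hδ.map_mul hT)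
  have hproj : Module.Projective H Q := projective_tMod hδ
  have hdim : Module.finrank ℂ Q = S.d i * S.e i := by
    rw [finrank_tMod, mul_comm]
    congr 1
    exact Subspace.dual_finrank_eq
  have hsum := S.finrank_eq_sum (Q := Q)
  rw [hdim] at hsum
  have hw : ∀ j, S.mult Q (S.perm φ j) * S.e (S.perm φ j) = S.mult Q j * S.e j := fun j => by
    rw [S.mult_perm hQ, S.e_perm]
  obtain ⟨j, hj, hjodd⟩ := exists_fixed_odd (τ := S.perm φ ^ n) (fun j => by
    rw [← Equiv.Perm.mul_apply, ← pow_add, hφ]; rfl) (w := fun j => S.mult Q j * S.e j)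
    (Equiv.Perm.pow_invariant (w := fun j => S.mult Q j * S.e j) hw n) (hsum ▸ hodd)
  have hej := (Nat.odd_mul.1 hjodd).2
  refine ⟨j, by_contra fun hne => ?_, hej⟩
  have hle := mul_le_sum_of_orbit (w := fun j => S.mult Q j * S.e j)
    (Equiv.Perm.dvd_of_zpow_fixed hn hj hne) hw
  rw [← hsum] at hle
  have hm := (Nat.odd_mul.1 hjodd).1.pos
  have h2 := hkey j hej
  have h3 : n * S.e j ≤ n * (S.mult Q j * S.e j) :=
    Nat.mul_le_mul_left _ (Nat.le_mul_of_pos_left _ hm)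
  have h4 := Nat.mul_le_mul_left n (h3.trans hle)
  rw [mul_assoc] at h2
  omega

end SimpleSystem

end Hopf

section Main
variable {H : Type} [Ring H] [HopfAlgebra ℂ H] [Module.Finite ℂ H]
open HopfAlgebra Coalgebra

theorem SimpleSystem.nonempty_oddSelfBidualProjective (S : SimpleSystem H) {s : H ≃ₐ[ℂ] H}
    (hs : ∀ x, s x = antipode ℂ (antipode ℂ x)) {i : S.ι} (hi : S.perm s i = i) (he : Odd (S.e i)) :
    Nonempty (OddSelfBidualProjective H) := by
  obtain ⟨a, ha⟩ : TwIso (S.P i) (S.P i) s := by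
    have h := S.twIso_P s i
    rwa [hi] at h
  exact ⟨{
    Q := S.P i
    finite := inferInstance
    nontrivial := Module.nontrivial_of_finrank_pos (R := ℂ) (S.e_pos i)
    indecomposable := (S.fitting i).not_isCompl
    projective := S.projective i
    odd_dim := he
    self_bidual := ⟨a, fun x v => by rw [ha, hs, pow_two]; rfl⟩ }⟩

theorem TensorProduct.map_comm_apply (f g : H →ₗ[ℂ] H) (t : H ⊗[ℂ] H) :
    TensorProduct.map f g (TensorProduct.comm ℂ H H t) =
      TensorProduct.comm ℂ H H (TensorProduct.map g f t) := by
  induction t with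
  | zero => simp
  | add x y hx hy => simp only [map_add, hx, hy]
  | tmul a b => simp

namespace RadfordSystem
variable (D : RadfordSystem ℂ H)

theorem map_r_l (c : ℤ) (x : H) :
    TensorProduct.map (D.r ^ (-c)).toLinearMap (D.l ^ c).toLinearMap (comul (R := ℂ) x) =
      comul (R := ℂ) x := by
  have h1 : ∀ t : H ⊗[ℂ] H,
      TensorProduct.map (D.r ^ (-c)).toLinearMap (D.l ^ c).toLinearMap t =
      TensorProduct.map LinearMap.id (D.l ^ c).toLinearMap
        (TensorProduct.map (D.r ^ (-c)).toLinearMap LinearMap.id t) := by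
    intro t
    rw [TensorProduct.map_map]; rfl
  rw [h1, map_r_pow, TensorProduct.map_map]
  have h2 : (D.l ^ c).toLinearMap ∘ₗ (D.l ^ (-c)).toLinearMap = LinearMap.id := by
    ext x
    simp
  rw [h2]
  exact LinearMap.congr_fun TensorProduct.map_id _

theorem map_mul_s (a b : H ≃ₐ[ℂ] H) (x : H) :
    TensorProduct.map (a * D.s).toLinearMap (b * D.s).toLinearMap (comul (R := ℂ) x) =
      TensorProduct.map a.toLinearMap b.toLinearMap (comul (R := ℂ) (D.s x)) := by
  rw [comul_s, TensorProduct.map_map]; rfl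

theorem perm_r (S : SimpleSystem H) : S.perm D.r = S.perm D.s * S.perm D.s * S.perm D.l := by
  rw [← map_mul, ← map_mul]
  exact (S.perm_eq_of_inner D.u D.radford).symm

theorem nonempty_of_perm_s_eq_r (S : SimpleSystem H) [Fintype S.ι] {c : ℤ} {i : S.ι}
    (hi : S.perm D.s i = ((S.perm D.r) ^ c) i) (hodd : Odd (S.d i * S.e i)) {n N : ℕ} (hn : n.Prime)
    (hφ : S.perm D.s ^ (n + n) = 1) (hbound : n * (S.d i * S.e i) ≤ N)
    (hkey : ∀ j, Odd (S.e j) → N < n * n * S.e j) : Nonempty (OddSelfBidualProjective H) := by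
  obtain ⟨j, hj, hj'⟩ := S.exists_fixed_of_twisted (isDiagonal_comul (k := ℂ) (H := H))
    antipode_one (φ := D.s) (ψ := D.r ^ (-c) * D.s) (ψ' := D.l ^ c * D.s)
    (fun x => by
      rw [AlgEquiv.mul_apply, AlgEquiv.mul_apply]
      have h := (D.pow_antipode (-c) (D.s x)).1
      rw [neg_neg] at h
      rw [← h]
      simp only [D.s_apply])
    (fun x => by
      rw [Bialgebra.comulAlgHom_apply, Bialgebra.comulAlgHom_apply, map_mul_s]
      exact (D.map_r_l c _).symm)
    (by rw [map_mul, map_zpow, zpow_neg, Equiv.Perm.mul_apply, hi, Equiv.Perm.inv_eq_iff_eq])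
    hodd hn hφ hbound hkey
  exact S.nonempty_oddSelfBidualProjective D.s_apply hj hj'

theorem nonempty_of_perm_s_eq_l (S : SimpleSystem H) [Fintype S.ι] {c : ℤ} {i : S.ι}
    (hi : S.perm D.s i = ((S.perm D.l) ^ c) i) (hodd : Odd (S.d i * S.e i)) {n N : ℕ} (hn : n.Prime)
    (hφ : S.perm D.s ^ (n + n) = 1) (hbound : n * (S.d i * S.e i) ≤ N)
    (hkey : ∀ j, Odd (S.e j) → N < n * n * S.e j) : Nonempty (OddSelfBidualProjective H) := by
  have h1 : D.T 1 = 1 := by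
    have := D.T_antipode 1
    rwa [antipode_one] at this
  obtain ⟨j, hj, hj'⟩ := S.exists_fixed_of_twisted
    (isDiagonal_cop D.T D.antipode_T D.T_antipode)
    h1 (φ := D.s) (ψ := D.l ^ (-c) * D.s) (ψ' := D.r ^ c * D.s)
    (fun x => by
      obtain ⟨y, rfl⟩ : ∃ y, antipode ℂ y = x := ⟨_, D.antipode_T x⟩
      rw [D.T_antipode, AlgEquiv.mul_apply, AlgEquiv.mul_apply, ← D.T_antipode ((D.l ^ (-c)) _),
        ← (D.pow_antipode c (D.s y)).1]
      simp only [D.s_apply])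
    (fun x => by
      rw [copAlgHom_apply, copAlgHom_apply, TensorProduct.map_comm_apply, map_mul_s]
      congr 1
      have h := D.map_r_l (-c) (D.s x)
      rw [neg_neg] at h
      exact h.symm)
    (by rw [map_mul, map_zpow, zpow_neg, Equiv.Perm.mul_apply, hi, Equiv.Perm.inv_eq_iff_eq])
    hodd hn hφ hbound hkey
  exact S.nonempty_oddSelfBidualProjective D.s_apply hj hj'

theorem nonempty_of_prime_orderOf (S : SimpleSystem H) (hn : (orderOf D.l).Prime)
    (hodd : Odd (Module.finrank ℂ H))
    (hkey : ∀ j, Odd (S.e j) → Module.finrank ℂ H < orderOf D.l * orderOf D.l * S.e j) :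
    Nonempty (OddSelfBidualProjective H) := by
  have := Fintype.ofFinite S.ι
  set n := orderOf D.l with hn_def
  let w : S.ι → ℕ := fun j => S.d j * S.e j
  have hw : ∀ (φ : H ≃ₐ[ℂ] H) j, w (S.perm φ j) = w j := fun φ j => by
    simp only [w, S.d_perm, S.e_perm]
  have hdim : Module.finrank ℂ H = ∑ j, w j := S.finrank_self
  have hl : D.l ^ n = 1 := pow_orderOf_eq_one _
  have hr : D.r ^ n = 1 := by
    have := D.r_pow_eq_one (n := n) (by rw [zpow_natCast, hl])
    rwa [zpow_natCast] at this
  have hL : S.perm D.l ^ n = 1 := by rw [← map_pow, hl, map_one]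
  have hR : S.perm D.r ^ n = 1 := by rw [← map_pow, hr, map_one]
  have hcomm : Commute (S.perm D.s) (S.perm D.l) := by
    have := congrArg S.perm D.l_comm_s
    rw [map_mul, map_mul] at this
    exact this.symm
  have hs : S.perm D.s ^ (n + n) = 1 := by
    have h := hR
    rwa [D.perm_r, (hcomm.mul_left hcomm).mul_pow, hL, mul_one, ← pow_two, ← pow_mul, two_mul] at h
  obtain ⟨i, hi, hiodd⟩ := exists_fixed_odd (τ := S.perm D.s ^ n) (fun j => by
    rw [← Equiv.Perm.mul_apply, ← pow_add, hs]; rfl) (w := w)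
    (Equiv.Perm.pow_invariant (hw D.s) n) (hdim ▸ hodd)
  have hei := (Nat.odd_mul.1 hiodd).2
  by_cases hsi : S.perm D.s i = i
  · exact S.nonempty_oddSelfBidualProjective D.s_apply hsi hei
  rcases orbit_trichotomy hn (hodd.of_dvd_nat D.orderOf_l_dvd) hcomm (D.perm_r S) hL hR (hw D.l)
    (hw D.r) hi hsi with h | ⟨c, hc, hne⟩ | ⟨c, hc, hne⟩
  · have h1 := hkey i hei
    have h2 : n * n * S.e i ≤ n * n * (S.d i * S.e i) :=
      Nat.mul_le_mul_left _ (Nat.le_mul_of_pos_left _ (S.d_pos i))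
    rw [← hdim] at h
    exact absurd (h2.trans h) (not_le.2 h1)
  · refine D.nonempty_of_perm_s_eq_r S hc hiodd hn hs ?_ hkey
    rw [hdim]
    exact mul_le_sum_of_orbit (Equiv.Perm.dvd_of_zpow_fixed hn (by rw [hR]; rfl) hne) (hw D.r)
  · refine D.nonempty_of_perm_s_eq_l S hc hiodd hn hs ?_ hkey
    rw [hdim]
    exact mul_le_sum_of_orbit (Equiv.Perm.dvd_of_zpow_fixed hn (by rw [hL]; rfl) hne) (hw D.l)

theorem nonempty_of_l_eq_one (S : SimpleSystem H) (hl : D.l = 1)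
    (hodd : Odd (Module.finrank ℂ H)) : Nonempty (OddSelfBidualProjective H) := by
  have := Fintype.ofFinite S.ι
  have hr : D.r = 1 := by
    have := D.r_pow_eq_one (n := 1) (by rw [zpow_one, hl])
    rwa [zpow_one] at this
  have hs := D.perm_r S
  rw [hr, hl, map_one, mul_one] at hs
  rw [S.finrank_self] at hodd
  obtain ⟨i, hi, hiodd⟩ := exists_fixed_odd (τ := S.perm D.s) (fun j => by
    rw [← Equiv.Perm.mul_apply, ← hs]; rfl) (fun j => by rw [S.d_perm, S.e_perm]) hodd
  exact S.nonempty_oddSelfBidualProjective D.s_apply hi (Nat.odd_mul.1 hiodd).2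

end RadfordSystem
end Main

end

/-- For a non-semisimple Hopf algebra `H` over `ℂ` of dimension `p·q`, where
`p < q ≤ 2p + 1` are odd primes, there exists an odd-dimensional indecomposable
projective `H`-module `Q` with `Q ≅ Q**`. -/
theorem exists_odd_self_bidual_projective (p q : ℕ) (hp : p.Prime) (hq : q.Prime)
    (hpodd : Odd p) (hqodd : Odd q) (hpq : p < q) (hq2p : q ≤ 2 * p + 1)
    (H : Type) [Ring H] [HopfAlgebra ℂ H]
    (hdim : Module.finrank ℂ H = p * q)
    (hns : ¬ IsSemisimpleRing H) :
    Nonempty (OddSelfBidualProjective H) := by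
  have hpos : 0 < p * q := Nat.mul_pos hp.pos hq.pos
  have : Module.Finite ℂ H := Module.finite_of_finrank_pos (hdim ▸ hpos)
  obtain ⟨D⟩ := nonempty_radfordSystem ℂ H
  obtain ⟨S⟩ := nonempty_simpleSystem H
  have hodd : Odd (Module.finrank ℂ H) := hdim ▸ hpodd.mul hqodd
  have he : ∀ i, S.e i ≠ 1 := fun i h => hns (isSemisimpleRing_of_finrank_eq_one (P := S.P i) h)
  have hn := D.orderOf_l_dvd
  rw [hdim] at hn
  have hkey : ∀ j, Odd (S.e j) → p * q < p * p * S.e j := by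
    intro j hj
    have h3 : 3 ≤ S.e j := by
      have := he j
      obtain ⟨m, hm⟩ := hj
      omega
    have h2 := hp.two_le
    rw [mul_assoc]
    exact Nat.mul_lt_mul_of_pos_left (by nlinarith) hp.pos
  have hkey' : ∀ j, Odd (S.e j) → p * q < q * q * S.e j := by
    intro j hj
    have h1 := S.e_pos j
    calc p * q < q * q := Nat.mul_lt_mul_of_pos_right hpq hq.pos
      _ ≤ q * q * S.e j := Nat.le_mul_of_pos_right _ h1
  have hcases : orderOf D.l = 1 ∨ orderOf D.l = p ∨ orderOf D.l = q := by
    obtain ⟨a, b, ha, hb, hab⟩ := (Nat.dvd_mul).1 hn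
    rcases (Nat.dvd_prime hp).1 ha with rfl | rfl <;> rcases (Nat.dvd_prime hq).1 hb with rfl | rfl
    · left; simpa using hab.symm
    · right; right; simpa using hab.symm
    · right; left; simpa using hab.symm
    · exfalso
      have := Fintype.ofFinite S.ι
      obtain ⟨i, hi⟩ := S.orderOf_l_mul_le D
      rw [hdim, ← hab] at hi
      have h1 : S.d i * S.e i ≤ 1 := by
        by_contra h
        nlinarith
      have := Nat.mul_le_mul_right (S.e i) (S.d_pos i)
      have := S.e_pos i
      have := he i
      omega
  rcases hcases with h | h | h
  · exact D.nonempty_of_l_eq_one S (orderOf_eq_one_iff.1 h) hodd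
  · exact D.nonempty_of_prime_orderOf S (h ▸ hp) hodd (by rwa [h, hdim])
  · exact D.nonempty_of_prime_orderOf S (h ▸ hq) hodd (by rwa [h, hdim])
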